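/- arXiv:2207.08446 — 10 statements merged into one kernel-verified Lean document; each statement's English description precedes it below -/
import Mathlib

section
/- In the cactus group J_{2n}, s'_{[p,q]} s'_{[k,l]} = s'_{[p+q−l, p+q−k]} s'_{[p,q]} for all 1 ≤ p ≤ k ≤ l ≤ q ≤ n−1. -/
/-- Index type for generators of a cactus group on a path with `N` nodes:
intervals `[p,q]` with `1 ≤ p ≤ q ≤ N`. -/
abbrev CactusIdx (N : ℕ) : Type := {pq : ℕ × ℕ // 1 ≤ pq.1 ∧ pq.1 ≤ pq.2 ∧ pq.2 ≤ N}

/-- Defining relations of the (type A) cactus group with `N` nodes: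
(1A) `s_{[p,q]}² = 1`; (2A) commutation for disjoint non-adjacent intervals;
(3A) `s_{[p,q]} s_{[k,l]} = s_{[p+q-l,p+q-k]} s_{[p,q]}` for `[k,l] ⊆ [p,q]`. -/
inductive CactusRel (N : ℕ) : FreeGroup (CactusIdx N) → Prop
  | sq (i : CactusIdx N) :
      CactusRel N (FreeGroup.of i * FreeGroup.of i)
  | comm (i j : CactusIdx N) (h : i.1.2 + 1 < j.1.1 ∨ j.1.2 + 1 < i.1.1) :
      CactusRel N (FreeGroup.of i * FreeGroup.of j * (FreeGroup.of i)⁻¹ * (FreeGroup.of j)⁻¹)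
  | nest (i j k : CactusIdx N) (h1 : i.1.1 ≤ j.1.1) (h2 : j.1.2 ≤ i.1.2)
      (h3 : k.1.1 = i.1.1 + i.1.2 - j.1.2) (h4 : k.1.2 = i.1.1 + i.1.2 - j.1.1) :
      CactusRel N (FreeGroup.of i * FreeGroup.of j * (FreeGroup.of i)⁻¹ * (FreeGroup.of k)⁻¹)

/-- The (type A) cactus group with `N` nodes (so `CactusGroup (2*n-1)` is `J_{2n}`
and `CactusGroup (n-1)` is `J_n`). -/
abbrev CactusGroup (N : ℕ) := PresentedGroup {x | CactusRel N x}

/-- The generator `s_{[p,q]}` of the cactus group (equal to `1` for invalid indices). -/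
def cactusGen (N p q : ℕ) : CactusGroup N :=
  if h : 1 ≤ p ∧ p ≤ q ∧ q ≤ N then PresentedGroup.of ⟨(p, q), h⟩ else 1

/-- `s'_{[p,q]} := s_{[p,q]} s_{[2n-q,2n-p]}` in the cactus group `J_{2n}`. -/
def sPrime (n p q : ℕ) : CactusGroup (2 * n - 1) :=
  cactusGen (2 * n - 1) p q * cactusGen (2 * n - 1) (2 * n - q) (2 * n - p)

theorem cactusGen_comm (N : ℕ) {p q k l : ℕ} (h : q + 1 < k) :
    Commute (cactusGen N p q) (cactusGen N k l) := by
  unfold cactusGen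
  split_ifs with hi hj
  · have hrel := PresentedGroup.one_of_mem (rels := {x | CactusRel N x})
      (CactusRel.comm ⟨(p, q), hi⟩ ⟨(k, l), hj⟩ (Or.inl h))
    simp only [map_mul, map_inv] at hrel
    exact mul_inv_eq_iff_eq_mul.mp (mul_inv_eq_one.mp hrel)
  all_goals simp

theorem cactusGen_nest (N : ℕ) {p q k l k' l' : ℕ} (hp : 1 ≤ p) (hpk : p ≤ k) (hkl : k ≤ l)
    (hlq : l ≤ q) (hq : q ≤ N) (hk' : k' = p + q - l) (hl' : l' = p + q - k) :
    cactusGen N p q * cactusGen N k l = cactusGen N k' l' * cactusGen N p q := by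
  have hi : 1 ≤ p ∧ p ≤ q ∧ q ≤ N := by omega
  have hj : 1 ≤ k ∧ k ≤ l ∧ l ≤ N := by omega
  have hk : 1 ≤ k' ∧ k' ≤ l' ∧ l' ≤ N := by omega
  have hrel := PresentedGroup.one_of_mem (rels := {x | CactusRel N x})
    (CactusRel.nest ⟨(p, q), hi⟩ ⟨(k, l), hj⟩ ⟨(k', l'), hk⟩ hpk hlq hk' hl')
  simp only [map_mul, map_inv] at hrel
  rw [cactusGen, dif_pos hi, cactusGen, dif_pos hj, cactusGen, dif_pos hk]
  exact mul_inv_eq_iff_eq_mul.mp (mul_inv_eq_one.mp hrel)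

/-- In `J_{2n}`: `s'_{[p,q]} s'_{[k,l]} = s'_{[p+q-l,p+q-k]} s'_{[p,q]}` for
`1 ≤ p ≤ k ≤ l ≤ q ≤ n-1`. -/
theorem stmt4 (n : ℕ) (hn : 2 ≤ n) (p q k l : ℕ)
    (hp : 1 ≤ p) (hpk : p ≤ k) (hkl : k ≤ l) (hlq : l ≤ q) (hq : q ≤ n - 1) :
    sPrime n p q * sPrime n k l = sPrime n (p + q - l) (p + q - k) * sPrime n p q := by
  have hbc : Commute (cactusGen (2 * n - 1) k l)
      (cactusGen (2 * n - 1) (2 * n - q) (2 * n - p)) := cactusGen_comm _ (by omega)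
  have haf : Commute (cactusGen (2 * n - 1) p q)
      (cactusGen (2 * n - 1) (2 * n - (p + q - k)) (2 * n - (p + q - l))) :=
    cactusGen_comm _ (by omega)
  have hac := cactusGen_nest (2 * n - 1) hp hpk hkl hlq (by omega) rfl rfl
  have hbd := cactusGen_nest (2 * n - 1) (p := 2 * n - q) (q := 2 * n - p)
    (k := 2 * n - l) (l := 2 * n - k) (k' := 2 * n - (p + q - k)) (l' := 2 * n - (p + q - l))
    (by omega) (by omega) (by omega) (by omega) (by omega) (by omega) (by omega)
  unfold sPrime
  rw [hbc.symm.mul_mul_mul_comm, hac, hbd, haf.mul_mul_mul_comm]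
end

section
/- The assignment s_{[p,q]} ↦ s'_{[p,q]} = s_{[p,q]} s_{[2n−q,2n−p]} for 1 ≤ p ≤ q ≤ n−1, and s_{[p,n]} ↦ s_{[p,2n−p]} for 1 ≤ p ≤ n, extends to a group homomorphism Γ : J_{sp(2n)} → J_{2n} (i.e. the images of the generators of J_{sp(2n)} satisfy all defining relations of J_{sp(2n)} inside J_{2n}). -/
/-- Defining relations of the symplectic cactus group `J_{sp(2n)}`, with generators
`s_{[p,q]}`, `1 ≤ p ≤ q ≤ n`: (1C) squares; (2C) commutation for disjoint
non-adjacent intervals; (3C-i) `s_{[p,n]}` commutes with `s_{[k,l]}` for `[k,l] ⊆ [p,n]`;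
(3C-ii) `s_{[p,q]} s_{[k,l]} = s_{[p+q-l,p+q-k]} s_{[p,q]}` for `[k,l] ⊆ [p,q] ⊆ [1,n-1]`. -/
inductive SpCactusRel (n : ℕ) : FreeGroup (CactusIdx n) → Prop
  | sq (i : CactusIdx n) :
      SpCactusRel n (FreeGroup.of i * FreeGroup.of i)
  | comm (i j : CactusIdx n) (h : i.1.2 + 1 < j.1.1 ∨ j.1.2 + 1 < i.1.1) :
      SpCactusRel n (FreeGroup.of i * FreeGroup.of j * (FreeGroup.of i)⁻¹ * (FreeGroup.of j)⁻¹)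
  | nestC (i j : CactusIdx n) (hq : i.1.2 = n) (h1 : i.1.1 ≤ j.1.1) :
      SpCactusRel n (FreeGroup.of i * FreeGroup.of j * (FreeGroup.of i)⁻¹ * (FreeGroup.of j)⁻¹)
  | nestA (i j k : CactusIdx n) (hq : i.1.2 ≤ n - 1) (h1 : i.1.1 ≤ j.1.1) (h2 : j.1.2 ≤ i.1.2)
      (h3 : k.1.1 = i.1.1 + i.1.2 - j.1.2) (h4 : k.1.2 = i.1.1 + i.1.2 - j.1.1) :
      SpCactusRel n (FreeGroup.of i * FreeGroup.of j * (FreeGroup.of i)⁻¹ * (FreeGroup.of k)⁻¹)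

/-- The symplectic cactus group `J_{sp(2n)}`. -/
abbrev SpCactusGroup (n : ℕ) := PresentedGroup {x | SpCactusRel n x}

/-- The generator `s_{[p,q]}` of `J_{sp(2n)}` (equal to `1` for invalid indices). -/
def spGen (n p q : ℕ) : SpCactusGroup n :=
  if h : 1 ≤ p ∧ p ≤ q ∧ q ≤ n then PresentedGroup.of ⟨(p, q), h⟩ else 1

theorem cactusGen_mul_self (N p q : ℕ) : cactusGen N p q * cactusGen N p q = 1 := by
  unfold cactusGen
  split_ifs with h
  · exact PresentedGroup.one_of_mem (CactusRel.sq ⟨(p, q), h⟩)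
  · simp

theorem cactusGen_commute (N : ℕ) {p q k l : ℕ} (h : q + 1 < k ∨ l + 1 < p) :
    Commute (cactusGen N p q) (cactusGen N k l) := by
  unfold cactusGen
  split_ifs with hi hj
  · have := PresentedGroup.one_of_mem (CactusRel.comm ⟨(p, q), hi⟩ ⟨(k, l), hj⟩ h)
    simp only [map_mul] at this
    exact mul_inv_eq_iff_eq_mul.mp (mul_inv_eq_one.mp this)
  all_goals simp

theorem cactusGen_semiconjBy (N : ℕ) {p q k l k' l' : ℕ} (hp : 1 ≤ p) (hq : q ≤ N)
    (hpk : p ≤ k) (hkl : k ≤ l) (hlq : l ≤ q) (hk' : k' = p + q - l) (hl' : l' = p + q - k) :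
    SemiconjBy (cactusGen N p q) (cactusGen N k l) (cactusGen N k' l') := by
  have hi : 1 ≤ p ∧ p ≤ q ∧ q ≤ N := by omega
  have hj : 1 ≤ k ∧ k ≤ l ∧ l ≤ N := by omega
  have hm : 1 ≤ k' ∧ k' ≤ l' ∧ l' ≤ N := by omega
  have := PresentedGroup.one_of_mem
    (CactusRel.nest ⟨(p, q), hi⟩ ⟨(k, l), hj⟩ ⟨(k', l'), hm⟩ hpk hlq hk' hl')
  simp only [map_mul] at this
  simp only [cactusGen, dif_pos hi, dif_pos hj, dif_pos hm]
  exact mul_inv_eq_iff_eq_mul.mp (mul_inv_eq_one.mp this)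

/-- The image of the generator `s_{[p,q]}` of `J_{sp(2n)}` in `J_{2n}`. -/
def foldGen (n p q : ℕ) : CactusGroup (2 * n - 1) :=
  if q = n then cactusGen (2 * n - 1) p (2 * n - p) else sPrime n p q

theorem foldGen_self (n p : ℕ) : foldGen n p n = cactusGen (2 * n - 1) p (2 * n - p) :=
  if_pos rfl

theorem foldGen_of_lt {n q : ℕ} (p : ℕ) (hq : q < n) : foldGen n p q = sPrime n p q :=
  if_neg hq.ne

theorem foldGen_mul_self {n p q : ℕ} (hq : q ≤ n) : foldGen n p q * foldGen n p q = 1 := by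
  rcases hq.eq_or_lt with rfl | hq
  · rw [foldGen_self, cactusGen_mul_self]
  · have h : Commute (cactusGen (2 * n - 1) p q) (cactusGen (2 * n - 1) (2 * n - q) (2 * n - p)) :=
      cactusGen_commute _ (by omega)
    rw [foldGen_of_lt p hq, sPrime, h.symm.mul_mul_mul_comm, cactusGen_mul_self,
      cactusGen_mul_self, one_mul]

theorem foldGen_commute {n p q k l : ℕ} (hpq : p ≤ q) (hkl : k ≤ l) (hl : l ≤ n)
    (h : q + 1 < k) : Commute (foldGen n p q) (foldGen n k l) := by
  rw [foldGen_of_lt p (by omega), sPrime]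
  rcases hl.eq_or_lt with rfl | hl
  · rw [foldGen_self]
    exact (cactusGen_commute _ (by omega)).mul_left (cactusGen_commute _ (by omega))
  · rw [foldGen_of_lt k hl, sPrime]
    exact ((cactusGen_commute _ (by omega)).mul_right (cactusGen_commute _ (by omega))).mul_left
      ((cactusGen_commute _ (by omega)).mul_right (cactusGen_commute _ (by omega)))

theorem foldGen_self_commute {n p k l : ℕ} (hp : 1 ≤ p) (hpk : p ≤ k) (hkl : k ≤ l)
    (hl : l ≤ n) : Commute (foldGen n p n) (foldGen n k l) := by
  rw [foldGen_self]
  rcases hl.eq_or_lt with rfl | hl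
  · rw [foldGen_self]
    exact cactusGen_semiconjBy _ hp (by omega) hpk (by omega) (by omega) (by omega) (by omega)
  · rw [foldGen_of_lt k hl, sPrime]
    have h : Commute (cactusGen (2 * n - 1) k l) (cactusGen (2 * n - 1) (2 * n - l) (2 * n - k)) :=
      cactusGen_commute _ (by omega)
    have hs : SemiconjBy (cactusGen (2 * n - 1) p (2 * n - p)) (cactusGen (2 * n - 1) k l)
        (cactusGen (2 * n - 1) (2 * n - l) (2 * n - k)) :=
      cactusGen_semiconjBy _ hp (by omega) hpk hkl (by omega) (by omega) (by omega)
    have hs' : SemiconjBy (cactusGen (2 * n - 1) p (2 * n - p))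
        (cactusGen (2 * n - 1) (2 * n - l) (2 * n - k)) (cactusGen (2 * n - 1) k l) :=
      cactusGen_semiconjBy _ hp (by omega) (by omega) (by omega) (by omega) (by omega) (by omega)
    have := hs.mul_right hs'
    rwa [← h.eq] at this

theorem foldGen_semiconjBy {n p q k l k' l' : ℕ} (hp : 1 ≤ p) (hq : q < n) (hpk : p ≤ k)
    (hkl : k ≤ l) (hlq : l ≤ q) (hk' : k' = p + q - l) (hl' : l' = p + q - k) :
    SemiconjBy (foldGen n p q) (foldGen n k l) (foldGen n k' l') := by
  rw [foldGen_of_lt p hq, foldGen_of_lt k (by omega), foldGen_of_lt k' (by omega),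
    sPrime, sPrime, sPrime]
  refine SemiconjBy.mul_right ?_ ?_
  · exact SemiconjBy.mul_left
      (cactusGen_semiconjBy _ hp (by omega) hpk hkl hlq hk' hl')
      (cactusGen_commute _ (by omega))
  · refine SemiconjBy.mul_left (cactusGen_commute _ (by omega)) ?_
    exact cactusGen_semiconjBy _ (by omega) (by omega) (by omega) (by omega) (by omega)
      (by omega) (by omega)

theorem lift_foldGen_eq_one {n : ℕ} {r : FreeGroup (CactusIdx n)}
    (hr : SpCactusRel n r) :
    FreeGroup.lift (fun i : CactusIdx n => foldGen n i.1.1 i.1.2) r = 1 := by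
  cases hr with
  | sq i => simpa using foldGen_mul_self i.2.2.2
  | comm i j h =>
    simp only [map_mul, map_inv, FreeGroup.lift_apply_of, mul_inv_eq_iff_eq_mul, one_mul]
    rcases h with h | h
    · exact foldGen_commute i.2.2.1 j.2.2.1 j.2.2.2 h
    · exact (foldGen_commute j.2.2.1 i.2.2.1 i.2.2.2 h).symm
  | nestC i j hq h1 =>
    simp only [map_mul, map_inv, FreeGroup.lift_apply_of, mul_inv_eq_iff_eq_mul, one_mul]
    rw [hq]
    exact foldGen_self_commute i.2.1 h1 j.2.2.1 j.2.2.2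
  | nestA i j k hq h1 h2 h3 h4 =>
    simp only [map_mul, map_inv, FreeGroup.lift_apply_of, mul_inv_eq_iff_eq_mul, one_mul]
    have hi : i.1.2 < n := by have := i.2; omega
    exact foldGen_semiconjBy i.2.1 hi h1 j.2.2.1 h2 h3 h4

/-- The assignment `s_{[p,q]} ↦ s'_{[p,q]}` (`1 ≤ p ≤ q ≤ n-1`) and
`s_{[p,n]} ↦ s_{[p,2n-p]}` (`1 ≤ p ≤ n`) extends to a group homomorphism
`Γ : J_{sp(2n)} → J_{2n}`. -/
theorem stmt5 (n : ℕ) (hn : 2 ≤ n) :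
    ∃ Γ : SpCactusGroup n →* CactusGroup (2 * n - 1),
      (∀ p q : ℕ, 1 ≤ p → p ≤ q → q ≤ n - 1 → Γ (spGen n p q) = sPrime n p q) ∧
      (∀ p : ℕ, 1 ≤ p → p ≤ n →
        Γ (spGen n p n) = cactusGen (2 * n - 1) p (2 * n - p)) := by
  refine ⟨PresentedGroup.toGroup (f := fun i : CactusIdx n => foldGen n i.1.1 i.1.2)
    fun r hr => lift_foldGen_eq_one hr, fun p q hp hpq hq => ?_, fun p hp hpn => ?_⟩
  · rw [spGen, dif_pos ⟨hp, hpq, by omega⟩, PresentedGroup.toGroup.of]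
    exact foldGen_of_lt p (show q < n by omega)
  · rw [spGen, dif_pos ⟨hp, hpn, le_rfl⟩, PresentedGroup.toGroup.of]
    exact foldGen_self n p
end

section
/- There is an injective group homomorphism J̃_{2n} → J_{2n} determined by s̃_{[p,q]∪[2n−q,2n−p]} ↦ s_{[p,q]} s_{[2n−q,2n−p]} for 1 ≤ p ≤ q ≤ n−1 and s̃_{[p,2n−p]} ↦ s_{[p,2n−p]} for 1 ≤ p ≤ n; thus the virtual symplectic cactus group J̃_{2n} is isomorphic to a subgroup of the cactus group J_{2n}. -/
/-- Defining relations of the virtual symplectic cactus group `J̃_{2n}`.  Its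
generators `s̃_J` are indexed by the subsets `J = [p,q] ∪ [2n-q,2n-p]`
(for `1 ≤ p ≤ q ≤ n-1`) and `J = [p,2n-p]` (for `1 ≤ p ≤ n`) of `[1,2n-1]`;
these subsets are in bijection with the intervals `[p,q] ⊆ [1,n]` (with `q = n`
corresponding to `J = [p,2n-p]`), which we use as the index type.  The relations
are (1Ã) squares, (2Ã) commutation when the corresponding intervals in `[1,n]`
are disjoint and non-adjacent, (3Ã-i) `s̃_{[p,2n-p]}` commutes with
`s̃_{[k,l]∪[2n-l,2n-k]}` for `[k,l] ⊆ [p,n]`, and (3Ã-ii)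
`s̃_{[p,q]∪[2n-q,2n-p]} s̃_{[k,l]∪[2n-l,2n-k]}
  = s̃_{[p+q-l,p+q-k]∪[2n-(p+q)+k,2n-(p+q)+l]} s̃_{[p,q]∪[2n-q,2n-p]}`
for `[k,l] ⊆ [p,q] ⊆ [1,n-1]`. -/
inductive VirtCactusRel (n : ℕ) : FreeGroup (CactusIdx n) → Prop
  | sq (i : CactusIdx n) :
      VirtCactusRel n (FreeGroup.of i * FreeGroup.of i)
  | comm (i j : CactusIdx n) (h : i.1.2 + 1 < j.1.1 ∨ j.1.2 + 1 < i.1.1) :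
      VirtCactusRel n (FreeGroup.of i * FreeGroup.of j * (FreeGroup.of i)⁻¹ * (FreeGroup.of j)⁻¹)
  | nestC (i j : CactusIdx n) (hq : i.1.2 = n) (h1 : i.1.1 ≤ j.1.1) :
      VirtCactusRel n (FreeGroup.of i * FreeGroup.of j * (FreeGroup.of i)⁻¹ * (FreeGroup.of j)⁻¹)
  | nestA (i j k : CactusIdx n) (hq : i.1.2 ≤ n - 1) (h1 : i.1.1 ≤ j.1.1) (h2 : j.1.2 ≤ i.1.2)
      (h3 : k.1.1 = i.1.1 + i.1.2 - j.1.2) (h4 : k.1.2 = i.1.1 + i.1.2 - j.1.1) :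
      VirtCactusRel n (FreeGroup.of i * FreeGroup.of j * (FreeGroup.of i)⁻¹ * (FreeGroup.of k)⁻¹)

/-- The virtual symplectic cactus group `J̃_{2n}`. -/
abbrev VirtCactusGroup (n : ℕ) := PresentedGroup {x | VirtCactusRel n x}

/-- The generator `s̃_{[p,q]∪[2n-q,2n-p]}` (for `q ≤ n-1`), resp. `s̃_{[p,2n-p]}`
(for `q = n`), of `J̃_{2n}` (equal to `1` for invalid indices). -/
def virtGen (n p q : ℕ) : VirtCactusGroup n :=
  if h : 1 ≤ p ∧ p ≤ q ∧ q ≤ n then PresentedGroup.of ⟨(p, q), h⟩ else 1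

namespace Cactus

section Pilings

open scoped Pointwise

variable {α : Type*}

/-- Two sets are compatible if they are nested or disjoint. -/
def Compat (S T : Set α) : Prop := S ⊆ T ∨ T ⊆ S ∨ Disjoint S T

theorem Compat.symm {S T : Set α} (h : Compat S T) : Compat T S := by
  rcases h with h | h | h
  exacts [Or.inr (Or.inl h), Or.inl h, Or.inr (Or.inr h.symm)]

theorem compat_smul_iff (w : Equiv.Perm α) {S T : Set α} :
    Compat (w • S) (w • T) ↔ Compat S T := by
  simp [Compat, Set.smul_set_subset_smul_set_iff, Set.disjoint_smul_set]

open Classical in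
/-- Add a bead labelled `S` on top of a piling: the stack over `S` receives the bead `true`, and
every stack over a set which is not compatible with `S` receives the bead `false`. -/
noncomputable def push (S : Set α) (f : Set α → List Bool) : Set α → List Bool := fun T =>
  if T = S then true :: f T else if Compat S T then f T else false :: f T

open Classical in
/-- Remove a bead labelled `S` from the top of a piling. -/
noncomputable def pop (S : Set α) (f : Set α → List Bool) : Set α → List Bool := fun T =>
  if T = S ∨ ¬ Compat S T then (f T).tail else f T

/-- The bead labelled `S` is accessible from the top of the piling. -/
def Top (f : Set α → List Bool) (S : Set α) : Prop := (f S).head? = some true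

theorem top_push {S T : Set α} {f : Set α → List Bool} :
    Top (push S f) T ↔ T = S ∨ Compat S T ∧ Top f T := by
  unfold Top push
  split_ifs with h₁ h₂ <;> simp [*]

theorem pop_push (S : Set α) (f : Set α → List Bool) : pop S (push S f) = f := by
  funext T
  unfold pop push
  split_ifs <;> simp_all

theorem push_comm {S T : Set α} (h : Compat S T) (f : Set α → List Bool) :
    push S (push T f) = push T (push S f) := by
  funext U
  have h' := h.symm
  unfold push
  split_ifs <;> simp_all

open Classical in
/-- Add a bead labelled `S`, cancelling it if such a bead is already on top. -/
noncomputable def toggle (S : Set α) (f : Set α → List Bool) : Set α → List Bool :=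
  if Top f S then pop S f else push S f

theorem toggle_push (S : Set α) (f : Set α → List Bool) : toggle S (push S f) = f := by
  rw [toggle, if_pos (top_push.2 (Or.inl rfl)), pop_push]

theorem toggle_of_not_top {S : Set α} {f : Set α → List Bool} (h : ¬ Top f S) :
    toggle S f = push S f := if_neg h

/-- The pilings obtained from the empty one by adding beads without cancellation. -/
inductive IsReduced : (Set α → List Bool) → Prop
  | nil : IsReduced fun _ => []
  | push (S : Set α) (f : Set α → List Bool) : IsReduced f → ¬ Top f S → IsReduced (push S f)

theorem IsReduced.exists_eq_push {f : Set α → List Bool} (hf : IsReduced f) {S : Set α}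
    (h : Top f S) : ∃ g, IsReduced g ∧ ¬ Top g S ∧ f = Cactus.push S g := by
  induction hf generalizing S with
  | nil => simp [Top] at h
  | push T f hf hT ih =>
    rcases top_push.1 h with rfl | ⟨hc, hS⟩
    · exact ⟨f, hf, hT, rfl⟩
    by_cases hST : S = T
    · subst hST; exact absurd hS hT
    obtain ⟨g, hg, hgS, rfl⟩ := ih hS
    refine ⟨Cactus.push T g, hg.push T g fun h => hT (top_push.2 (Or.inr ⟨hc.symm, h⟩)), ?_,
      push_comm hc g⟩
    rw [top_push]
    tauto

theorem IsReduced.toggle {f : Set α → List Bool} (hf : IsReduced f) (S : Set α) :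
    IsReduced (toggle S f) := by
  by_cases h : Top f S
  · obtain ⟨g, hg, -, rfl⟩ := hf.exists_eq_push h
    rwa [toggle_push]
  · rw [toggle_of_not_top h]
    exact hf.push S f h

theorem IsReduced.toggle_toggle {f : Set α → List Bool} (hf : IsReduced f) (S : Set α) :
    Cactus.toggle S (Cactus.toggle S f) = f := by
  by_cases h : Top f S
  · obtain ⟨g, hg, hgS, rfl⟩ := hf.exists_eq_push h
    rw [toggle_push, toggle_of_not_top hgS]
  · rw [toggle_of_not_top h, toggle_push]

theorem IsReduced.toggle_comm_of_not_top {f : Set α → List Bool} (hf : IsReduced f) {S T : Set α}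
    (h : Compat S T) (hne : S ≠ T) (hS : ¬ Top f S) :
    Cactus.toggle S (Cactus.toggle T f) = Cactus.toggle T (Cactus.toggle S f) := by
  rw [toggle_of_not_top hS]
  by_cases hT : Top f T
  · obtain ⟨g, hg, hgT, rfl⟩ := hf.exists_eq_push hT
    have hgS : ¬ Top g S := fun h' => hS (top_push.2 (Or.inr ⟨h.symm, h'⟩))
    rw [toggle_push, push_comm h, toggle_push, toggle_of_not_top hgS]
  · rw [toggle_of_not_top hT, toggle_of_not_top, toggle_of_not_top, push_comm h] <;>
    · rw [top_push]; tauto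

theorem IsReduced.toggle_comm {f : Set α → List Bool} (hf : IsReduced f) {S T : Set α}
    (h : Compat S T) :
    Cactus.toggle S (Cactus.toggle T f) = Cactus.toggle T (Cactus.toggle S f) := by
  rcases eq_or_ne S T with rfl | hne
  · rfl
  by_cases hS : Top f S
  · obtain ⟨g, hg, hgS, rfl⟩ := hf.exists_eq_push hS
    have := hg.toggle_comm_of_not_top h hne hgS
    rw [toggle_push, ← toggle_of_not_top hgS, ← this, (hg.toggle T).toggle_toggle]
  · exact hf.toggle_comm_of_not_top h hne hS

/-- Transport the labels of the beads of a piling along a permutation. -/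
def transport (w : Equiv.Perm α) (f : Set α → List Bool) : Set α → List Bool := fun T => f (w⁻¹ • T)

theorem top_transport {w : Equiv.Perm α} {f : Set α → List Bool} {S : Set α} :
    Top (transport w f) S ↔ Top f (w⁻¹ • S) := Iff.rfl

theorem transport_push (w : Equiv.Perm α) (S : Set α) (f : Set α → List Bool) :
    transport w (push S f) = push (w • S) (transport w f) := by
  funext T
  have h₁ : w⁻¹ • T = S ↔ T = w • S := inv_smul_eq_iff
  have h₂ : Compat S (w⁻¹ • T) ↔ Compat (w • S) T := by
    rw [← compat_smul_iff w, smul_inv_smul]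
  simp only [transport, push]
  split_ifs <;> simp_all

theorem IsReduced.transport {f : Set α → List Bool} (hf : IsReduced f) (w : Equiv.Perm α) :
    IsReduced (transport w f) := by
  induction hf with
  | nil => exact IsReduced.nil
  | push S f hf hS ih =>
    rw [transport_push]
    refine ih.push _ _ ?_
    rwa [top_transport, inv_smul_smul]

theorem IsReduced.transport_toggle {f : Set α → List Bool} (hf : IsReduced f) (w : Equiv.Perm α)
    (S : Set α) :
    Cactus.transport w (Cactus.toggle S f) = Cactus.toggle (w • S) (Cactus.transport w f) := by
  by_cases h : Top f S
  · obtain ⟨g, hg, hgS, rfl⟩ := hf.exists_eq_push h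
    rw [toggle_push, transport_push, toggle_push]
  · rw [toggle_of_not_top h, toggle_of_not_top, transport_push]
    rwa [top_transport, inv_smul_smul]

variable (α) in
/-- The reduced pilings labelled by subsets of `α`. -/
abbrev Piling := {f : Set α → List Bool // IsReduced f}

/-- Toggling as a permutation of the reduced pilings. -/
noncomputable def togglePerm (S : Set α) : Equiv.Perm (Piling α) :=
  Function.Involutive.toPerm (fun f => ⟨toggle S f.1, f.2.toggle S⟩)
    fun f => Subtype.ext (f.2.toggle_toggle S)

/-- Transport as an action on the reduced pilings. -/
def transportPerm : Equiv.Perm α →* Equiv.Perm (Piling α) where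
  toFun w :=
    { toFun f := ⟨transport w f.1, f.2.transport w⟩
      invFun f := ⟨transport w⁻¹ f.1, f.2.transport w⁻¹⟩
      left_inv f := Subtype.ext (by funext T; simp [transport])
      right_inv f := Subtype.ext (by funext T; simp [transport]) }
  map_one' := by ext f T : 3; simp [transport]
  map_mul' v w := by ext f T : 3; simp [transport, mul_smul]

theorem togglePerm_mul_self (S : Set α) : togglePerm S * togglePerm S = 1 :=
  Equiv.ext fun f => Subtype.ext (f.2.toggle_toggle S)

theorem togglePerm_comm {S T : Set α} (h : Compat S T) :
    togglePerm S * togglePerm T = togglePerm T * togglePerm S :=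
  Equiv.ext fun f => Subtype.ext (f.2.toggle_comm h)

theorem transportPerm_mul_togglePerm (w : Equiv.Perm α) (S : Set α) :
    transportPerm w * togglePerm S = togglePerm (w • S) * transportPerm w :=
  Equiv.ext fun f => Subtype.ext (f.2.transport_toggle w S)

theorem togglePerm_mul_transportPerm_mul (S T : Set α) (v w : Equiv.Perm α) :
    togglePerm S * transportPerm v * (togglePerm T * transportPerm w) =
      togglePerm S * togglePerm (v • T) * transportPerm (v * w) := by
  rw [mul_assoc, ← mul_assoc (transportPerm v), transportPerm_mul_togglePerm, map_mul]
  simp only [mul_assoc]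

end Pilings

section Flips

open Set
open scoped Pointwise

/-- The permutation of `ℤ` reversing the interval `[a, b]` and fixing all other points. -/
def flip (a b : ℤ) : Equiv.Perm ℤ :=
  Function.Involutive.toPerm (fun x => if a ≤ x ∧ x ≤ b then a + b - x else x) fun x => by grind

theorem flip_apply (a b x : ℤ) : flip a b x = if a ≤ x ∧ x ≤ b then a + b - x else x := rfl

theorem flip_mul_self (a b : ℤ) : flip a b * flip a b = 1 := by
  ext x
  simp only [Equiv.Perm.mul_apply, flip_apply, Equiv.Perm.one_apply]
  grind

theorem flip_inv (a b : ℤ) : (flip a b)⁻¹ = flip a b :=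
  inv_eq_of_mul_eq_one_right (flip_mul_self a b)

theorem mem_flip_smul {a b x : ℤ} {S : Set ℤ} : x ∈ flip a b • S ↔ flip a b x ∈ S := by
  rw [mem_smul_set_iff_inv_smul_mem, flip_inv, Equiv.Perm.smul_def]

theorem flip_smul_Icc_of_le {a b c d : ℤ} (h₁ : a ≤ c) (h₂ : d ≤ b) :
    flip a b • Icc c d = Icc (a + b - d) (a + b - c) := by
  ext x
  simp only [mem_flip_smul, flip_apply, mem_Icc]
  grind

theorem flip_smul_Icc_of_ge {a b c d : ℤ} (h₁ : c ≤ a) (h₂ : b ≤ d) :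
    flip a b • Icc c d = Icc c d := by
  ext x
  simp only [mem_flip_smul, flip_apply, mem_Icc]
  grind

theorem flip_smul_Icc_of_disjoint {a b c d : ℤ} (h : b < c ∨ d < a) :
    flip a b • Icc c d = Icc c d := by
  ext x
  simp only [mem_flip_smul, flip_apply, mem_Icc]
  grind

theorem flip_mul_flip_of_le {a b c d : ℤ} (h₁ : a ≤ c) (h₂ : d ≤ b) :
    flip a b * flip c d = flip (a + b - d) (a + b - c) * flip a b := by
  ext x
  simp only [Equiv.Perm.mul_apply, flip_apply]
  grind

theorem flip_mul_flip_of_disjoint {a b c d : ℤ} (h : b < c ∨ d < a) :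
    flip a b * flip c d = flip c d * flip a b := by
  ext x
  simp only [Equiv.Perm.mul_apply, flip_apply]
  grind

theorem compat_Icc_iff {a b c d : ℤ} (h₁ : a ≤ b) (h₂ : c ≤ d) :
    Compat (Icc a b) (Icc c d) ↔ c ≤ a ∧ b ≤ d ∨ a ≤ c ∧ d ≤ b ∨ b < c ∨ d < a := by
  rw [Compat, Icc_subset_Icc_iff h₁, Icc_subset_Icc_iff h₂, disjoint_iff_inter_eq_empty,
    Icc_inter_Icc, Icc_eq_empty_iff]
  grind

/-- Reverse the interval `[a, b]` and toggle the corresponding bead. -/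
noncomputable def bead (a b : ℤ) : Equiv.Perm (Piling ℤ) :=
  togglePerm (Icc a b) * transportPerm (flip a b)

theorem bead_mul_self (a b : ℤ) : bead a b * bead a b = 1 := by
  rw [bead, togglePerm_mul_transportPerm_mul, flip_smul_Icc_of_ge le_rfl le_rfl,
    togglePerm_mul_self, flip_mul_self, map_one, one_mul]

theorem bead_comm {a b c d : ℤ} (hab : a ≤ b) (hcd : c ≤ d) (h : b < c ∨ d < a) :
    bead a b * bead c d = bead c d * bead a b := by
  rw [bead, bead, togglePerm_mul_transportPerm_mul, togglePerm_mul_transportPerm_mul,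
    flip_smul_Icc_of_disjoint h, flip_smul_Icc_of_disjoint h.symm, flip_mul_flip_of_disjoint h,
    togglePerm_comm ((compat_Icc_iff hab hcd).2 (Or.inr (Or.inr h)))]

theorem bead_mul_bead {a b c d : ℤ} (hab : a ≤ b) (hcd : c ≤ d) (h₁ : a ≤ c) (h₂ : d ≤ b) :
    bead a b * bead c d = bead (a + b - d) (a + b - c) * bead a b := by
  rw [bead, bead, bead, togglePerm_mul_transportPerm_mul, togglePerm_mul_transportPerm_mul,
    flip_smul_Icc_of_le h₁ h₂, flip_smul_Icc_of_ge (by lia) (by lia), flip_mul_flip_of_le h₁ h₂,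
    togglePerm_comm ((compat_Icc_iff hab (by lia)).2 (by lia))]

end Flips

section CactusGroup

theorem mul_mul_inv_mul_inv_eq_one_iff {G : Type*} [Group G] {x y z : G} :
    x * y * x⁻¹ * z⁻¹ = 1 ↔ x * y = z * x := by
  rw [mul_inv_eq_one, mul_inv_eq_iff_eq_mul]

/-- The action of the cactus group on the pilings labelled by sets of integers. -/
noncomputable def action (N : ℕ) : CactusGroup N →* Equiv.Perm (Piling ℤ) :=
  PresentedGroup.toGroup (f := fun i : CactusIdx N => bead i.1.1 (i.1.2 + 1)) <| by
    rintro _ (⟨i⟩ | ⟨i, j, h⟩ | ⟨i, j, k, h₁, h₂, h₃, h₄⟩)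
    · simpa using bead_mul_self _ _
    · have hi := i.2
      have hj := j.2
      simpa [mul_mul_inv_mul_inv_eq_one_iff] using
        bead_comm (by lia) (by lia) (by lia : (i.1.2 : ℤ) + 1 < j.1.1 ∨ (j.1.2 : ℤ) + 1 < i.1.1)
    · have hi := i.2
      have hj := j.2
      have hk : (k.1.1 : ℤ) = i.1.1 + (i.1.2 + 1) - (j.1.2 + 1) ∧
          (k.1.2 : ℤ) + 1 = i.1.1 + (i.1.2 + 1) - j.1.1 := by lia
      simp only [map_mul, FreeGroup.lift_apply_of, map_inv, mul_mul_inv_mul_inv_eq_one_iff, hk]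
      exact bead_mul_bead (by lia) (by lia) (by lia) (by lia)

theorem action_cactusGen {N p q : ℕ} (h₁ : 1 ≤ p) (h₂ : p ≤ q) (h₃ : q ≤ N) :
    action N (cactusGen N p q) = bead p (q + 1) := by
  rw [cactusGen, dif_pos ⟨h₁, h₂, h₃⟩, action, PresentedGroup.toGroup.of]

theorem cactusGen_mul_self (N p q : ℕ) : cactusGen N p q * cactusGen N p q = 1 := by
  unfold cactusGen
  split_ifs with h
  · exact PresentedGroup.one_of_mem (CactusRel.sq _)
  · exact mul_one 1

theorem cactusGen_comm {N p q k l : ℕ} (h : q + 1 < k ∨ l + 1 < p) :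
    cactusGen N p q * cactusGen N k l = cactusGen N k l * cactusGen N p q := by
  unfold cactusGen
  split_ifs with h₁ h₂
  · exact mul_mul_inv_mul_inv_eq_one_iff.1 (PresentedGroup.one_of_mem (CactusRel.comm _ _ h))
  all_goals simp

theorem cactusGen_mul {N p q k l : ℕ} (hp : 1 ≤ p) (hq : q ≤ N) (h₁ : p ≤ k) (hkl : k ≤ l)
    (h₂ : l ≤ q) :
    cactusGen N p q * cactusGen N k l = cactusGen N (p + q - l) (p + q - k) * cactusGen N p q := by
  rw [cactusGen, dif_pos (by lia), cactusGen, dif_pos (by lia), cactusGen, dif_pos (by lia)]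
  exact mul_mul_inv_mul_inv_eq_one_iff.1
    (PresentedGroup.one_of_mem (CactusRel.nest _ _ _ h₁ h₂ rfl rfl))

theorem sPrime_comm {n p q k l : ℕ} (hpq : p ≤ q) (hq : q < n) (hl : l < n)
    (h : q + 1 < k ∨ l + 1 < p) : sPrime n p q * sPrime n k l = sPrime n k l * sPrime n p q := by
  unfold sPrime
  have : ∀ {a b c d e f : ℕ}, b + 1 < c ∨ d + 1 < a → b + 1 < e ∨ f + 1 < a →
      Commute (cactusGen (2 * n - 1) a b)
        (cactusGen (2 * n - 1) c d * cactusGen (2 * n - 1) e f) := fun h₁ h₂ =>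
    Commute.mul_right (cactusGen_comm h₁) (cactusGen_comm h₂)
  exact Commute.mul_left (this (by lia) (by lia)) (this (by lia) (by lia))

theorem cactusGen_mul_sPrime_of_disjoint {n p k l : ℕ} (hp : p ≤ n) (h : l + 1 < p) :
    cactusGen (2 * n - 1) p (2 * n - p) * sPrime n k l =
      sPrime n k l * cactusGen (2 * n - 1) p (2 * n - p) :=
  Commute.mul_right (cactusGen_comm (by lia)) (cactusGen_comm (by lia))

theorem cactusGen_mul_sPrime {n p k l : ℕ} (hp : 1 ≤ p) (h : p ≤ k) (hkl : k ≤ l) (hl : l < n) :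
    cactusGen (2 * n - 1) p (2 * n - p) * sPrime n k l =
      sPrime n k l * cactusGen (2 * n - 1) p (2 * n - p) := by
  have h₁ := cactusGen_mul (N := 2 * n - 1) (q := 2 * n - p) hp (by lia) h hkl (by lia)
  have h₂ := cactusGen_mul (N := 2 * n - 1) (p := p) (q := 2 * n - p) (k := 2 * n - l)
    (l := 2 * n - k) hp (by lia) (by lia) (by lia) (by lia)
  have h₃ := cactusGen_comm (N := 2 * n - 1) (p := k) (q := l) (k := 2 * n - l) (l := 2 * n - k)
    (by lia)
  rw [show p + (2 * n - p) - l = 2 * n - l by lia, show p + (2 * n - p) - k = 2 * n - k by lia]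
    at h₁
  rw [show p + (2 * n - p) - (2 * n - k) = k by lia,
    show p + (2 * n - p) - (2 * n - l) = l by lia] at h₂
  rw [sPrime, ← mul_assoc, h₁, mul_assoc, h₂, ← mul_assoc, h₃]

theorem sPrime_mul_sPrime {n p q k l : ℕ} (hp : 1 ≤ p) (hq : q < n) (h₁ : p ≤ k) (hkl : k ≤ l)
    (h₂ : l ≤ q) :
    sPrime n p q * sPrime n k l = sPrime n (p + q - l) (p + q - k) * sPrime n p q := by
  have e₁ := cactusGen_mul (N := 2 * n - 1) hp (by lia) h₁ hkl h₂
  have e₂ := cactusGen_mul (N := 2 * n - 1) (p := 2 * n - q) (q := 2 * n - p) (k := 2 * n - l)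
    (l := 2 * n - k) (by lia) (by lia) (by lia) (by lia) (by lia)
  have e₃ := cactusGen_comm (N := 2 * n - 1) (p := k) (q := l) (k := 2 * n - q) (l := 2 * n - p)
    (by lia)
  have e₄ := cactusGen_comm (N := 2 * n - 1) (p := p) (q := q) (k := 2 * n - (p + q - k))
    (l := 2 * n - (p + q - l)) (by lia)
  rw [show 2 * n - q + (2 * n - p) - (2 * n - k) = 2 * n - (p + q - k) by lia,
    show 2 * n - q + (2 * n - p) - (2 * n - l) = 2 * n - (p + q - l) by lia] at e₂
  unfold sPrime
  rw [mul_assoc, ← mul_assoc _ (cactusGen _ k l), ← e₃, mul_assoc, e₂, ← mul_assoc, e₁,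
    mul_assoc, ← mul_assoc (cactusGen _ p q), e₄]
  simp only [mul_assoc]

theorem sPrime_mul_self {n p q : ℕ} (hq : q < n) :
    sPrime n p q * sPrime n p q = 1 := by
  have h := cactusGen_comm (N := 2 * n - 1) (p := p) (q := q) (k := 2 * n - q) (l := 2 * n - p)
    (by lia)
  unfold sPrime
  nth_rewrite 2 [h]
  rw [mul_assoc, ← mul_assoc (cactusGen _ (2 * n - q) _), cactusGen_mul_self, one_mul,
    cactusGen_mul_self]

/-- The homomorphism from the virtual symplectic cactus group to the cactus group. -/
noncomputable def folding (n : ℕ) : VirtCactusGroup n →* CactusGroup (2 * n - 1) :=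
  PresentedGroup.toGroup (f := fun i : CactusIdx n => if i.1.2 = n then
      cactusGen (2 * n - 1) i.1.1 (2 * n - i.1.1) else sPrime n i.1.1 i.1.2) <| by
    rintro _ (⟨⟨⟨p, q⟩, hi⟩⟩ | ⟨⟨⟨p, q⟩, hi⟩, ⟨⟨k, l⟩, hj⟩, h⟩ |
      ⟨⟨⟨p, q⟩, hi⟩, ⟨⟨k, l⟩, hj⟩, hq, h⟩ |
      ⟨⟨⟨p, q⟩, hi⟩, ⟨⟨k, l⟩, hj⟩, ⟨⟨k', l'⟩, hk⟩, hq, h₁, h₂, h₃, h₄⟩)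
    all_goals
      simp only [map_mul, FreeGroup.lift_apply_of, map_inv, mul_mul_inv_mul_inv_eq_one_iff] at *
    · split_ifs with h
      · exact cactusGen_mul_self _ _ _
      · exact sPrime_mul_self (by lia)
    · split_ifs with hqn hln hln
      · lia
      · exact cactusGen_mul_sPrime_of_disjoint (by lia) (by lia)
      · exact (cactusGen_mul_sPrime_of_disjoint (by lia) (by lia)).symm
      · exact sPrime_comm (by lia) (by lia) (by lia) h
    · rw [if_pos hq]
      split_ifs with hln
      · rw [cactusGen_mul (by lia) (by lia) h (by lia) (by lia)]
        congr 2 <;> lia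
      · exact cactusGen_mul_sPrime (by lia) h (by lia) (by lia)
    · rw [if_neg (by lia), if_neg (by lia), if_neg (by lia), h₃, h₄]
      exact sPrime_mul_sPrime (by lia) (by lia) h₁ (by lia) h₂

end CactusGroup

section Exchange

variable {G ι : Type*} [Group G]

/-- The elements built from `1` by multiplying on the left by generators `s i`, where at each step
the generator `s i` is not accessible in the previous element. -/
inductive Built (s : ι → G) (top : G → ι → Prop) : G → Prop
  | one : Built s top 1
  | mul (i : ι) (g : G) : Built s top g → ¬ top g i → Built s top (s i * g)

/-- Suppose that each group element has a set `top g` of accessible generators, changing under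
left multiplication by generators as in a right-angled Coxeter group twisted by `act`. Then an
element without accessible generators is trivial. -/
theorem eq_one_of_forall_not_top {s : ι → G} (hs : ∀ i, s i * s i = 1)
    (hgen : Subgroup.closure (Set.range s) = ⊤) {orth : ι → ι → Prop} {act : ι → ι → ι}
    (horth : ∀ {i k}, orth i k → orth (act i k) i)
    (hact : ∀ {i k}, orth i k → i ≠ k → act (act i k) i ≠ k ∧ orth (act (act i k) i) k ∧
      act (act (act i k) i) k = act i k)
    (hmul : ∀ {i k}, orth i k → s i * s (act i k) = s k * s (act (act i k) i))
    {top : G → ι → Prop} (htop_one : ∀ i, ¬ top 1 i)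
    (htop_mul : ∀ {g i}, ¬ top g i → ∀ k, top (s i * g) k ↔ k = i ∨ orth i k ∧ top g (act i k))
    {g : G} (hg : ∀ i, ¬ top g i) : g = 1 := by
  have key : ∀ {g}, Built s top g → ∀ {k}, top g k →
      ∃ h, Built s top h ∧ ¬ top h k ∧ g = s k * h := by
    intro g hg
    induction hg with
    | one => exact fun h => absurd h (htop_one _)
    | mul i g hg hi ih =>
      intro k hk
      by_cases hik : i = k
      · subst hik
        exact ⟨g, hg, hi, rfl⟩
      obtain ⟨ho, hk⟩ := ((htop_mul hi k).1 hk).resolve_left (Ne.symm hik)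
      obtain ⟨h, hh, hj, rfl⟩ := ih hk
      obtain ⟨h₁, h₂, h₃⟩ := hact ho hik
      have hj' : ¬ top h (act (act i k) i) := fun h' =>
        hi ((htop_mul hj i).2 (Or.inr ⟨horth ho, h'⟩))
      refine ⟨s (act (act i k) i) * h, hh.mul _ _ hj', ?_, ?_⟩
      · rw [htop_mul hj', h₃]
        rintro (h' | ⟨-, h'⟩)
        exacts [h₁ h'.symm, hj h']
      · rw [← mul_assoc, hmul ho, mul_assoc]
  have step : ∀ i g, Built s top g → Built s top (s i * g) := by
    intro i g hg
    by_cases hi : top g i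
    · obtain ⟨h, hh, -, rfl⟩ := key hg hi
      rwa [← mul_assoc, hs, one_mul]
    · exact hg.mul i g hi
  have built : ∀ g, Built s top g := by
    intro g
    have hmem : g ∈ Subgroup.closure (Set.range s) := hgen ▸ Subgroup.mem_top g
    induction hmem using Subgroup.closure_induction_left with
    | one => exact Built.one
    | mul_left x hx y hy ih =>
      obtain ⟨i, rfl⟩ := hx
      exact step i y ih
    | inv_mul_cancel x hx y hy ih =>
      obtain ⟨i, rfl⟩ := hx
      rw [inv_eq_of_mul_eq_one_right (hs i)]
      exact step i y ih
  cases built g with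
  | one => rfl
  | mul i g hg' hi => exact absurd ((htop_mul hi i).2 (Or.inl rfl)) (hg i)

end Exchange

section Indices

variable {n : ℕ}

/-- Two intervals are orthogonal if they are nested or disjoint and non-adjacent. -/
def Orth (i k : CactusIdx n) : Prop :=
  i.1.1 ≤ k.1.1 ∧ k.1.2 ≤ i.1.2 ∨ k.1.1 ≤ i.1.1 ∧ i.1.2 ≤ k.1.2 ∨
    i.1.2 + 1 < k.1.1 ∨ k.1.2 + 1 < i.1.1

/-- The interval obtained from `k` by reversing `i`, if `k` is contained in `i` and `i` does not
contain the node `n`. -/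
def reflect (i k : CactusIdx n) : CactusIdx n :=
  if h : i.1.2 < n ∧ i.1.1 ≤ k.1.1 ∧ k.1.2 ≤ i.1.2 then
    ⟨(i.1.1 + i.1.2 - k.1.2, i.1.1 + i.1.2 - k.1.1), by have := i.2; have := k.2; lia⟩
  else k

theorem reflect_fst (i k : CactusIdx n) : (reflect i k).1.1 =
    if i.1.2 < n ∧ i.1.1 ≤ k.1.1 ∧ k.1.2 ≤ i.1.2 then i.1.1 + i.1.2 - k.1.2 else k.1.1 := by
  unfold reflect
  split_ifs <;> rfl

theorem reflect_snd (i k : CactusIdx n) : (reflect i k).1.2 =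
    if i.1.2 < n ∧ i.1.1 ≤ k.1.1 ∧ k.1.2 ≤ i.1.2 then i.1.1 + i.1.2 - k.1.1 else k.1.2 := by
  unfold reflect
  split_ifs <;> rfl

theorem idx_ext_iff {i k : CactusIdx n} : i = k ↔ i.1.1 = k.1.1 ∧ i.1.2 = k.1.2 := by
  rw [Subtype.ext_iff, Prod.ext_iff]

theorem reflect_reflect (i k : CactusIdx n) : reflect i (reflect i k) = k := by
  have hi := i.2
  have hk := k.2
  simp only [idx_ext_iff, reflect_fst, reflect_snd]
  grind

theorem Orth.symm {i k : CactusIdx n} (h : Orth i k) : Orth k i := by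
  unfold Orth at *
  lia

theorem Orth.reflect {i k : CactusIdx n} (h : Orth i k) : Orth i (reflect i k) := by
  have hi := i.2
  have hk := k.2
  simp only [Orth, reflect_fst, reflect_snd] at *
  grind

theorem reflect_reflect_left {i k : CactusIdx n} (h : Orth i k) (hne : i ≠ k) :
    Cactus.reflect (Cactus.reflect i k) i ≠ k ∧
      Orth (Cactus.reflect (Cactus.reflect i k) i) k ∧
      Cactus.reflect (Cactus.reflect (Cactus.reflect i k) i) k = Cactus.reflect i k := by
  have hi := i.2
  have hk := k.2
  simp only [Orth, idx_ext_iff, reflect_fst, reflect_snd, Ne] at *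
  grind

theorem of_mul_self (i : CactusIdx n) :
    (PresentedGroup.of i : VirtCactusGroup n) * PresentedGroup.of i = 1 :=
  PresentedGroup.one_of_mem (VirtCactusRel.sq i)

theorem of_mul_of {i k : CactusIdx n} (h : Orth i k) :
    (PresentedGroup.of i : VirtCactusGroup n) * PresentedGroup.of k =
      PresentedGroup.of (reflect i k) * PresentedGroup.of (reflect k i) := by
  have nest : ∀ {i k : CactusIdx n}, i.1.1 ≤ k.1.1 → k.1.2 ≤ i.1.2 →
      (PresentedGroup.of i : VirtCactusGroup n) * PresentedGroup.of k =
        PresentedGroup.of (reflect i k) * PresentedGroup.of i := by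
    intro i k h₁ h₂
    have hi := i.2
    refine mul_mul_inv_mul_inv_eq_one_iff.1 (PresentedGroup.one_of_mem ?_)
    rcases hi.2.2.lt_or_eq with hn | hn
    · exact VirtCactusRel.nestA i k _ (by lia) h₁ h₂ (by rw [reflect_fst, if_pos (by lia)])
        (by rw [reflect_snd, if_pos (by lia)])
    · rw [reflect, dif_neg (by lia)]
      exact VirtCactusRel.nestC i k hn h₁
  have fix : ∀ {i k : CactusIdx n}, i.1.1 ≤ k.1.1 → k.1.2 ≤ i.1.2 → reflect k i = i := by
    intro i k h₁ h₂
    have hi := i.2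
    have hk := k.2
    simp only [idx_ext_iff, reflect_fst, reflect_snd]
    grind
  rcases h with ⟨h₁, h₂⟩ | ⟨h₁, h₂⟩ | h
  · rw [nest h₁ h₂, fix h₁ h₂]
  · have hk : k.1.1 ≤ (reflect k i).1.1 ∧ (reflect k i).1.2 ≤ k.1.2 := by
      have hi := i.2
      rw [reflect_fst, reflect_snd]
      grind
    rw [fix h₁ h₂, nest hk.1 hk.2, reflect_reflect]
  · have hi := i.2
    have hk := k.2
    rw [reflect, dif_neg (by lia), reflect, dif_neg (by lia)]
    exact mul_mul_inv_mul_inv_eq_one_iff.1 (PresentedGroup.one_of_mem (VirtCactusRel.comm i k h))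

end Indices

section Folding

open Set
open scoped Pointwise

variable {n : ℕ}

/-- The reflection of `ℤ` exchanging `1` and `2 * n`. -/
def mirror (n : ℕ) : Equiv.Perm ℤ := Equiv.subLeft (2 * n + 1 : ℤ)

theorem mirror_apply (x : ℤ) : mirror n x = 2 * n + 1 - x := rfl

theorem mirror_inv : (mirror n)⁻¹ = mirror n :=
  inv_eq_of_mul_eq_one_right (by ext x; simp [mirror_apply])

theorem mirror_smul_Icc (a b : ℤ) :
    mirror n • Icc a b = Icc (2 * n + 1 - b) (2 * n + 1 - a) := by
  ext x
  rw [mem_smul_set_iff_inv_smul_mem, mirror_inv, Equiv.Perm.smul_def, mirror_apply]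
  simp only [mem_Icc]
  lia

theorem mirror_mul_flip (a b : ℤ) :
    mirror n * flip a b = flip (2 * n + 1 - b) (2 * n + 1 - a) * mirror n := by
  ext x
  simp only [Equiv.Perm.mul_apply, flip_apply, mirror_apply]
  grind

/-- The last point of the block of `i`. -/
def lastPoint (i : CactusIdx n) : ℤ := if i.1.2 = n then 2 * n + 1 - i.1.1 else i.1.2 + 1

/-- The points reversed by the first factor of the folded generator of index `i`. -/
def block (i : CactusIdx n) : Set ℤ := Icc i.1.1 (lastPoint i)

/-- The permutation underlying the folded generator of index `i`. -/
def foldedFlip (i : CactusIdx n) : Equiv.Perm ℤ :=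
  if i.1.2 = n then flip i.1.1 (lastPoint i)
  else flip i.1.1 (lastPoint i) * flip (2 * n + 1 - lastPoint i) (2 * n + 1 - i.1.1)

theorem foldedFlip_mul_self (i : CactusIdx n) : foldedFlip i * foldedFlip i = 1 := by
  have hi := i.2
  unfold foldedFlip
  split_ifs with h
  · exact flip_mul_self _ _
  · have hl : lastPoint i = i.1.2 + 1 := if_neg h
    nth_rewrite 2 [flip_mul_flip_of_disjoint (by lia)]
    rw [mul_assoc, ← mul_assoc (flip (2 * n + 1 - lastPoint i) _), flip_mul_self, one_mul,
      flip_mul_self]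

theorem foldedFlip_inv (i : CactusIdx n) : (foldedFlip i)⁻¹ = foldedFlip i :=
  inv_eq_of_mul_eq_one_right (foldedFlip_mul_self i)

theorem mirror_smul_block (i : CactusIdx n) :
    mirror n • block i = Icc (2 * n + 1 - lastPoint i) (2 * n + 1 - i.1.1 : ℤ) :=
  mirror_smul_Icc _ _

theorem mirror_smul_mirror_smul (S : Set ℤ) : mirror n • mirror n • S = S := by
  nth_rewrite 1 [← mirror_inv]
  exact inv_smul_smul _ _

theorem mirror_mul_foldedFlip (i : CactusIdx n) :
    mirror n * foldedFlip i = foldedFlip i * mirror n := by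
  have hi := i.2
  unfold foldedFlip
  split_ifs with h
  · have hl : lastPoint i = 2 * n + 1 - i.1.1 := if_pos h
    rw [mirror_mul_flip, hl, sub_sub_cancel]
  · have hl : lastPoint i = i.1.2 + 1 := if_neg h
    rw [← mul_assoc, mirror_mul_flip, mul_assoc, mirror_mul_flip, ← mul_assoc, sub_sub_cancel,
      sub_sub_cancel, flip_mul_flip_of_disjoint (by lia)]

theorem le_lastPoint (i : CactusIdx n) : (i.1.1 : ℤ) ≤ lastPoint i := by
  have hi := i.2
  unfold lastPoint
  lia

theorem orth_iff_compat {i k : CactusIdx n} :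
    Orth i k ↔ Compat (block i) (block k) ∧ Compat (mirror n • block i) (block k) := by
  have hi := i.2
  have hk := k.2
  have hi' := le_lastPoint i
  rw [mirror_smul_block, block, block, compat_Icc_iff hi' (le_lastPoint k),
    compat_Icc_iff (by lia) (le_lastPoint k)]
  unfold lastPoint Orth
  grind

theorem compat_mirror_smul_block (i : CactusIdx n) : Compat (block i) (mirror n • block i) :=
  (orth_iff_compat.1 (Or.inl ⟨le_rfl, le_rfl⟩)).2.symm

theorem mirror_smul_block_of_eq {i : CactusIdx n} (h : i.1.2 = n) :
    mirror n • block i = block i := by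
  have hl : lastPoint i = 2 * n + 1 - i.1.1 := if_pos h
  rw [mirror_smul_block, block, hl, sub_sub_cancel]

theorem action_folding_of (i : CactusIdx n) :
    action (2 * n - 1) (folding n (PresentedGroup.of i)) =
      (if i.1.2 = n then togglePerm (block i)
        else togglePerm (block i) * togglePerm (mirror n • block i)) *
        transportPerm (foldedFlip i) := by
  have hi := i.2
  rw [folding, PresentedGroup.toGroup.of]
  unfold foldedFlip
  split_ifs with h
  · have hl : lastPoint i = 2 * n + 1 - i.1.1 := if_pos h
    rw [action_cactusGen (by lia) (by lia) (by lia), bead, block, hl]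
    congr 3 <;> lia
  · have hl : lastPoint i = i.1.2 + 1 := if_neg h
    have e₁ : ((2 * n - i.1.2 : ℕ) : ℤ) = 2 * n + 1 - (i.1.2 + 1) := by lia
    have e₂ : ((2 * n - i.1.1 : ℕ) : ℤ) + 1 = 2 * n + 1 - i.1.1 := by lia
    rw [sPrime, map_mul, action_cactusGen (by lia) (by lia) (by lia),
      action_cactusGen (by lia) (by lia) (by lia), e₁, e₂, bead, bead,
      togglePerm_mul_transportPerm_mul, flip_smul_Icc_of_disjoint (by lia), mirror_smul_block,
      block, hl]

/-- The piling obtained by applying an element of the virtual symplectic cactus group to the empty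
piling. -/
noncomputable def piling (g : VirtCactusGroup n) : Piling ℤ :=
  action (2 * n - 1) (folding n g) ⟨_, IsReduced.nil⟩

theorem commute_action_folding (g : VirtCactusGroup n) :
    Commute (transportPerm (mirror n)) (action (2 * n - 1) (folding n g)) := by
  have h : Subgroup.closure (range PresentedGroup.of) ≤
      (Subgroup.centralizer {transportPerm (mirror n)}).comap
        ((action (2 * n - 1)).comp (folding n)) := by
    rw [Subgroup.closure_le]
    rintro _ ⟨i, rfl⟩
    refine Subgroup.mem_centralizer_singleton_iff.2 (Commute.symm ?_)
    rw [MonoidHom.comp_apply, action_folding_of]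
    refine Commute.mul_right ?_ ?_
    · split_ifs with hn
      · rw [commute_iff_eq, transportPerm_mul_togglePerm, mirror_smul_block_of_eq hn]
      · rw [commute_iff_eq, ← mul_assoc, transportPerm_mul_togglePerm, mul_assoc,
          transportPerm_mul_togglePerm, mirror_smul_mirror_smul, ← mul_assoc,
          togglePerm_comm (compat_mirror_smul_block i)]
    · rw [commute_iff_eq, ← map_mul, mirror_mul_foldedFlip, map_mul]
  rw [PresentedGroup.closure_range_of] at h
  exact (Subgroup.mem_centralizer_singleton_iff.1 (h (Subgroup.mem_top g))).symm

theorem top_mirror_smul {g : VirtCactusGroup n} {S : Set ℤ} :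
    Top (piling g).1 (mirror n • S) ↔ Top (piling g).1 S := by
  have h : transport (mirror n) (piling g).1 = (piling g).1 :=
    congrArg Subtype.val (DFunLike.congr_fun (commute_action_folding g).eq
      (⟨fun _ => [], IsReduced.nil⟩ : Piling ℤ))
  conv_rhs => rw [← h, top_transport, mirror_inv]

theorem foldedFlip_smul_block (i : CactusIdx n) : foldedFlip i • block i = block i := by
  have hi := i.2
  unfold foldedFlip
  split_ifs with h
  · exact flip_smul_Icc_of_ge le_rfl le_rfl
  · have hl : lastPoint i = i.1.2 + 1 := if_neg h
    rw [mul_smul, block, flip_smul_Icc_of_disjoint (by lia), flip_smul_Icc_of_ge le_rfl le_rfl]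

theorem foldedFlip_smul_block_of_orth {i k : CactusIdx n} (h : Orth i k) :
    foldedFlip i • block k = block (reflect i k) ∨
      foldedFlip i • block k = mirror n • block (reflect i k) := by
  have hi := i.2
  have hk := k.2
  unfold Orth at h
  by_cases hn : i.1.2 = n
  · have hl : lastPoint i = 2 * n + 1 - i.1.1 := if_pos hn
    rw [foldedFlip, if_pos hn, reflect, dif_neg (by lia), mirror_smul_block, block]
    by_cases hik : i.1.1 ≤ k.1.1
    · right
      rw [flip_smul_Icc_of_le (by lia) (by unfold lastPoint at *; lia), hl]
      congr 1 <;> lia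
    · left
      by_cases hkn : k.1.2 = n
      · exact flip_smul_Icc_of_ge (by lia) (by unfold lastPoint at *; lia)
      · exact flip_smul_Icc_of_disjoint (by unfold lastPoint at *; lia)
  · left
    have hl : lastPoint i = i.1.2 + 1 := if_neg hn
    rw [foldedFlip, if_neg hn, mul_smul, block, block]
    by_cases hik : i.1.1 ≤ k.1.1 ∧ k.1.2 ≤ i.1.2
    · have hk' : lastPoint k = k.1.2 + 1 := if_neg (by lia)
      have hr : lastPoint (reflect i k) = i.1.1 + i.1.2 - k.1.1 + 1 := by
        have hs : (reflect i k).1.2 = i.1.1 + i.1.2 - k.1.1 := by rw [reflect_snd, if_pos (by lia)]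
        rw [lastPoint, if_neg (by lia), hs]
        lia
      rw [flip_smul_Icc_of_disjoint (by lia), flip_smul_Icc_of_le (by lia) (by lia), hr,
        reflect_fst, if_pos (by lia)]
      congr 1 <;> lia
    · rw [reflect, dif_neg (by lia)]
      by_cases hik' : k.1.1 ≤ i.1.1 ∧ i.1.2 ≤ k.1.2
      · have hle : lastPoint i ≤ lastPoint k := by unfold lastPoint; lia
        by_cases hkn : k.1.2 = n
        · have hk' : lastPoint k = 2 * n + 1 - k.1.1 := if_pos hkn
          rw [flip_smul_Icc_of_ge (by lia) (by lia), flip_smul_Icc_of_ge (by lia) hle]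
        · have hk' : lastPoint k = k.1.2 + 1 := if_neg hkn
          rw [flip_smul_Icc_of_disjoint (by lia), flip_smul_Icc_of_ge (by lia) hle]
      · rw [flip_smul_Icc_of_disjoint (by unfold lastPoint at *; lia),
          flip_smul_Icc_of_disjoint (by unfold lastPoint at *; lia)]

theorem eq_of_block_eq {i k : CactusIdx n}
    (h : block k = block i ∨ block k = mirror n • block i) : k = i := by
  have hi := i.2
  have hk := k.2
  rw [mirror_smul_block, block, block, Icc_eq_Icc_iff (le_lastPoint k),
    Icc_eq_Icc_iff (le_lastPoint k)] at h
  unfold lastPoint at h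
  rw [idx_ext_iff]
  grind

theorem piling_of_mul (g : VirtCactusGroup n) (i : CactusIdx n) (h : ¬ Top (piling g).1 (block i)) :
    (piling (PresentedGroup.of i * g)).1 =
      if i.1.2 = n then push (block i) (transport (foldedFlip i) (piling g).1)
      else push (block i) (push (mirror n • block i) (transport (foldedFlip i) (piling g).1)) := by
  have h₁ : ¬ Top (transport (foldedFlip i) (piling g).1) (block i) := by
    rwa [top_transport, foldedFlip_inv, foldedFlip_smul_block]
  rw [piling, map_mul, map_mul, Equiv.Perm.mul_apply, action_folding_of]
  split_ifs with hn
  · exact toggle_of_not_top h₁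
  · have h₂ : ¬ Top (transport (foldedFlip i) (piling g).1) (mirror n • block i) := by
      rwa [top_transport, foldedFlip_inv, ← mul_smul, ← mirror_mul_foldedFlip, mul_smul,
        foldedFlip_smul_block, top_mirror_smul]
    have h₃ : block i ≠ mirror n • block i := by
      have hi := i.2
      have hl : lastPoint i = i.1.2 + 1 := if_neg hn
      rw [mirror_smul_block, block, Ne, Icc_eq_Icc_iff (le_lastPoint i)]
      lia
    change toggle (block i)
      (toggle (mirror n • block i) (transport (foldedFlip i) (piling g).1)) = _
    rw [toggle_of_not_top h₂, toggle_of_not_top]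
    rw [top_push]
    tauto

theorem top_piling_of_mul {g : VirtCactusGroup n} {i : CactusIdx n}
    (h : ¬ Top (piling g).1 (block i)) (k : CactusIdx n) :
    Top (piling (PresentedGroup.of i * g)).1 (block k) ↔
      k = i ∨ Orth i k ∧ Top (piling g).1 (block (reflect i k)) := by
  have h₁ : Top (piling (PresentedGroup.of i * g)).1 (block k) ↔
      (block k = block i ∨ block k = mirror n • block i) ∨
        (Compat (block i) (block k) ∧ Compat (mirror n • block i) (block k)) ∧
          Top (transport (foldedFlip i) (piling g).1) (block k) := by
    rw [piling_of_mul g i h]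
    split_ifs with hn
    · rw [top_push, mirror_smul_block_of_eq hn]
      tauto
    · have hc := compat_mirror_smul_block i
      rw [top_push, top_push]
      constructor
      · tauto
      · rintro ((h | h) | h)
        · exact Or.inl h
        · exact Or.inr ⟨h ▸ hc, Or.inl h⟩
        · tauto
  rw [h₁, ← orth_iff_compat, top_transport, foldedFlip_inv]
  refine or_congr ⟨eq_of_block_eq, fun h => Or.inl (h ▸ rfl)⟩ (and_congr_right fun ho => ?_)
  rcases foldedFlip_smul_block_of_orth ho with e | e <;> rw [e]
  exact top_mirror_smul

theorem folding_injective : Function.Injective (folding n) := by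
  rw [injective_iff_map_eq_one]
  intro g hg
  refine eq_one_of_forall_not_top of_mul_self (PresentedGroup.closure_range_of _)
    (orth := Orth) (act := reflect) (fun h => h.reflect.symm) reflect_reflect_left (fun h => ?_)
    (top := fun g i => Top (piling g).1 (block i)) (fun i => ?_) top_piling_of_mul (fun i => ?_)
  · rw [of_mul_of h.reflect, reflect_reflect]
  · simp [piling, Top]
  · simp [piling, hg, Top]

end Folding

end Cactus

/-- There is an injective group homomorphism `J̃_{2n} → J_{2n}` determined by
`s̃_{[p,q]∪[2n-q,2n-p]} ↦ s_{[p,q]} s_{[2n-q,2n-p]}` (`1 ≤ p ≤ q ≤ n-1`) and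
`s̃_{[p,2n-p]} ↦ s_{[p,2n-p]}` (`1 ≤ p ≤ n`); thus `J̃_{2n}` is isomorphic to a
subgroup of `J_{2n}`. -/
theorem stmt8 (n : ℕ) (hn : 2 ≤ n) :
    ∃ ψ : VirtCactusGroup n →* CactusGroup (2 * n - 1),
      Function.Injective ψ ∧
      (∀ p q : ℕ, 1 ≤ p → p ≤ q → q ≤ n - 1 → ψ (virtGen n p q) = sPrime n p q) ∧
      (∀ p : ℕ, 1 ≤ p → p ≤ n →
        ψ (virtGen n p n) = cactusGen (2 * n - 1) p (2 * n - p)) := by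
  refine ⟨Cactus.folding n, Cactus.folding_injective, fun p q hp hpq hq => ?_, fun p hp hpn => ?_⟩
  · rw [virtGen, dif_pos (by lia), Cactus.folding, PresentedGroup.toGroup.of, if_neg (by grind)]
  · rw [virtGen, dif_pos (by lia), Cactus.folding, PresentedGroup.toGroup.of, if_pos rfl]
end

section
/- The assignment s_{[p,q]} ↦ s_{[p,q]} for all intervals [p,q] with 1 ≤ p ≤ q ≤ n−1 extends to an injective group homomorphism J_n → J_{sp(2n)}; i.e. the type A cactus group J_n is a subgroup of the symplectic cactus group J_{sp(2n)} (this is the Levi-subalgebra instance sl(n,ℂ) ⊂ sp(2n,ℂ) of the proposition that J_𝔩 is a subgroup of J_𝔤 for a Levi subalgebra 𝔩 ⊂ 𝔤). -/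
namespace CactusGroup

theorem of_eq_cactusGen {N : ℕ} (i : CactusIdx N) :
    (PresentedGroup.of i : CactusGroup N) = cactusGen N i.1.1 i.1.2 := by
  rw [cactusGen, dif_pos i.2]

theorem gen_eq_one {N p q : ℕ} (h : N < q) : cactusGen N p q = 1 :=
  dif_neg fun h' => absurd h'.2.2 (not_le.mpr h)

theorem gen_sq (N p q : ℕ) : cactusGen N p q * cactusGen N p q = 1 := by
  unfold cactusGen
  split_ifs with h
  · exact PresentedGroup.one_of_mem (CactusRel.sq ⟨(p, q), h⟩)
  · exact one_mul 1

theorem gen_comm {N p q k l : ℕ} (h : q + 1 < k ∨ l + 1 < p) :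
    cactusGen N p q * cactusGen N k l * (cactusGen N p q)⁻¹ * (cactusGen N k l)⁻¹ = 1 := by
  unfold cactusGen
  split_ifs with h₁ h₂
  · exact PresentedGroup.one_of_mem (CactusRel.comm ⟨(p, q), h₁⟩ ⟨(k, l), h₂⟩ h)
  all_goals simp

theorem gen_nest {N p q k l : ℕ} (hp : 1 ≤ p) (hq : q ≤ N) (hk : p ≤ k) (hkl : k ≤ l)
    (hl : l ≤ q) :
    cactusGen N p q * cactusGen N k l * (cactusGen N p q)⁻¹ *
      (cactusGen N (p + q - l) (p + q - k))⁻¹ = 1 := by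
  unfold cactusGen
  rw [dif_pos (by omega), dif_pos (by omega), dif_pos (by omega)]
  exact PresentedGroup.one_of_mem (CactusRel.nest ⟨(p, q), by omega⟩ ⟨(k, l), by omega⟩
    ⟨(p + q - l, p + q - k), by omega⟩ hk hl rfl rfl)

/-- The homomorphism `J_n → J_{sp(2n)}` fixing the generators. -/
def toSp (n : ℕ) : CactusGroup (n - 1) →* SpCactusGroup n :=
  PresentedGroup.toGroup
    (f := fun i => PresentedGroup.of ⟨i.1, i.2.1, i.2.2.1, i.2.2.2.trans (n.sub_le 1)⟩) <| by
    rintro _ (⟨i⟩ | ⟨i, j, h⟩ | ⟨i, j, k, h₁, h₂, h₃, h₄⟩) <;>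
      simp only [map_mul, map_inv, FreeGroup.lift_apply_of]
    · exact PresentedGroup.one_of_mem (SpCactusRel.sq _)
    · exact PresentedGroup.one_of_mem (SpCactusRel.comm _ _ h)
    · exact PresentedGroup.one_of_mem (SpCactusRel.nestA _ _ _ i.2.2.2 h₁ h₂ h₃ h₄)

theorem toSp_gen {n p q : ℕ} (hp : 1 ≤ p) (hpq : p ≤ q) (hq : q ≤ n - 1) :
    toSp n (cactusGen (n - 1) p q) = spGen n p q := by
  rw [cactusGen, dif_pos ⟨hp, hpq, hq⟩, spGen, dif_pos ⟨hp, hpq, by omega⟩]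
  exact PresentedGroup.toGroup.of _

/-- The retraction `J_{sp(2n)} → J_n` killing the generators `s_{[p,n]}`. -/
def ofSp (n : ℕ) (hn : 1 ≤ n) : SpCactusGroup n →* CactusGroup (n - 1) :=
  PresentedGroup.toGroup (f := fun i => cactusGen (n - 1) i.1.1 i.1.2) <| by
    rintro _ (⟨i⟩ | ⟨i, j, h⟩ | ⟨i, j, hq, h₁⟩ | ⟨i, j, k, hq, h₁, h₂, h₃, h₄⟩) <;>
      simp only [map_mul, map_inv, FreeGroup.lift_apply_of]
    · exact gen_sq _ _ _
    · exact gen_comm h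
    · rw [gen_eq_one (q := i.1.2) (by omega)]
      simp
    · rw [h₃, h₄]
      exact gen_nest i.2.1 hq h₁ j.2.2.1 h₂

theorem ofSp_comp_toSp (n : ℕ) (hn : 1 ≤ n) :
    (ofSp n hn).comp (toSp n) = MonoidHom.id _ := by
  refine PresentedGroup.ext fun i => ?_
  rw [MonoidHom.comp_apply, MonoidHom.id_apply, toSp, PresentedGroup.toGroup.of, ofSp,
    PresentedGroup.toGroup.of, of_eq_cactusGen]

theorem toSp_injective (n : ℕ) (hn : 1 ≤ n) : Function.Injective (toSp n) :=
  Function.LeftInverse.injective (g := ofSp n hn) (DFunLike.congr_fun (ofSp_comp_toSp n hn))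

end CactusGroup

/-- The assignment `s_{[p,q]} ↦ s_{[p,q]}` (`1 ≤ p ≤ q ≤ n-1`) extends to an
injective group homomorphism `J_n → J_{sp(2n)}`: the type A cactus group is a
subgroup of the symplectic cactus group. -/
theorem stmt9 (n : ℕ) (hn : 2 ≤ n) :
    ∃ f : CactusGroup (n - 1) →* SpCactusGroup n,
      Function.Injective f ∧
      ∀ p q : ℕ, 1 ≤ p → p ≤ q → q ≤ n - 1 →
        f (cactusGen (n - 1) p q) = spGen n p q :=
  ⟨CactusGroup.toSp n, CactusGroup.toSp_injective n (by omega),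
    fun _ _ => CactusGroup.toSp_gen⟩
end

section
/- The cactus group J_n is generated by the n−1 elements s_{[1,k]}, 1 ≤ k ≤ n−1 (the subgroup generated by these elements is all of J_n). -/
/-- Every generator `s_{[p,q]}` is the conjugate of `s_{[1,q-p+1]}` by `s_{[1,q]}`. -/
theorem cactusGen_eq_conj {N p q : ℕ} (hp : 1 ≤ p) (hpq : p ≤ q) (hq : q ≤ N) :
    cactusGen N p q = cactusGen N 1 q * cactusGen N 1 (q - p + 1) * (cactusGen N 1 q)⁻¹ := by
  have hi : 1 ≤ 1 ∧ 1 ≤ q ∧ q ≤ N := by omega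
  have hj : 1 ≤ 1 ∧ 1 ≤ q - p + 1 ∧ q - p + 1 ≤ N := by omega
  have hk : 1 ≤ p ∧ p ≤ q ∧ q ≤ N := ⟨hp, hpq, hq⟩
  rw [cactusGen, cactusGen, cactusGen, dif_pos hi, dif_pos hj, dif_pos hk]
  have hrel : CactusRel N _ := .nest ⟨(1, q), hi⟩ ⟨(1, q - p + 1), hj⟩ ⟨(p, q), hk⟩
    le_rfl (by dsimp only; omega) (by dsimp only; omega) (by dsimp only; omega)
  exact (mul_inv_eq_one.mp (PresentedGroup.one_of_mem hrel)).symm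

/-- The cactus group `J_n` is generated by the `n-1` elements `s_{[1,k]}`,
`1 ≤ k ≤ n-1`. -/
theorem stmt11 (n : ℕ) (hn : 2 ≤ n) :
    Subgroup.closure
      {x : CactusGroup (n - 1) | ∃ k, 1 ≤ k ∧ k ≤ n - 1 ∧ x = cactusGen (n - 1) 1 k} = ⊤ := by
  rw [eq_top_iff, ← PresentedGroup.closure_range_of, Subgroup.closure_le]
  rintro _ ⟨⟨⟨p, q⟩, hp, hpq, hq⟩, rfl⟩
  dsimp only at hp hpq hq
  have hgen : cactusGen (n - 1) p q = PresentedGroup.of ⟨(p, q), hp, hpq, hq⟩ := by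
    simp only [cactusGen, hp, hpq, hq, and_self, dite_true]
  rw [← hgen, cactusGen_eq_conj hp hpq hq]
  have hmem (k : ℕ) (h1 : 1 ≤ k) (hk : k ≤ n - 1) : cactusGen (n - 1) 1 k ∈ Subgroup.closure
      {x : CactusGroup (n - 1) | ∃ k, 1 ≤ k ∧ k ≤ n - 1 ∧ x = cactusGen (n - 1) 1 k} :=
    Subgroup.subset_closure ⟨k, h1, hk, rfl⟩
  have hq_mem := hmem q (by omega) hq
  exact mul_mem (mul_mem hq_mem (hmem (q - p + 1) (by omega) (by omega))) (inv_mem hq_mem)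
end

section
/- The cactus group J_n is generated by the n−1 elements s_{[i,n−1]}, 1 ≤ i ≤ n−1 (these are obtained from the generators s_{[1,k]} by conjugation with s_{[1,n−1]}). -/
theorem cactusGen_eq_of (N p q : ℕ) (h : 1 ≤ p ∧ p ≤ q ∧ q ≤ N) :
    cactusGen N p q = PresentedGroup.of ⟨(p, q), h⟩ :=
  dif_pos h

/-- Conjugating `s_{[p,q]}` by `s_{[p,N]}` gives `s_{[p+N-q,N]}`. -/
theorem cactusGen_conj_suffix {N p q : ℕ} (h : 1 ≤ p ∧ p ≤ q ∧ q ≤ N) :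
    cactusGen N p N * cactusGen N p q * (cactusGen N p N)⁻¹ = cactusGen N (p + N - q) N := by
  obtain ⟨h1, h2, h3⟩ := h
  rw [cactusGen_eq_of N p N ⟨h1, h2.trans h3, le_rfl⟩, cactusGen_eq_of N p q ⟨h1, h2, h3⟩,
    cactusGen_eq_of N (p + N - q) N (by omega), ← mul_inv_eq_one]
  exact PresentedGroup.one_of_mem (CactusRel.nest (N := N) ⟨(p, N), h1, h2.trans h3, le_rfl⟩
    ⟨(p, q), h1, h2, h3⟩ ⟨(p + N - q, N), by omega, by omega, le_rfl⟩ le_rfl h3 rfl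
    (Nat.add_sub_cancel_left p N).symm)

/-- The cactus group `J_n` is generated by the `n-1` elements `s_{[i,n-1]}`,
`1 ≤ i ≤ n-1`. -/
theorem stmt12 (n : ℕ) (hn : 2 ≤ n) :
    Subgroup.closure
      {x : CactusGroup (n - 1) | ∃ i, 1 ≤ i ∧ i ≤ n - 1 ∧ x = cactusGen (n - 1) i (n - 1)} = ⊤ := by
  set H := Subgroup.closure
    {x : CactusGroup (n - 1) | ∃ i, 1 ≤ i ∧ i ≤ n - 1 ∧ x = cactusGen (n - 1) i (n - 1)}
  have suffix_mem (i : ℕ) (h1 : 1 ≤ i) (h2 : i ≤ n - 1) : cactusGen (n - 1) i (n - 1) ∈ H :=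
    Subgroup.subset_closure ⟨i, h1, h2, rfl⟩
  rw [eq_top_iff, ← PresentedGroup.closure_range_of, Subgroup.closure_le]
  rintro _ ⟨⟨⟨p, q⟩, h⟩, rfl⟩
  obtain ⟨h1, h2, h3⟩ : 1 ≤ p ∧ p ≤ q ∧ q ≤ n - 1 := h
  have hp := suffix_mem p h1 (h2.trans h3)
  have hconj := suffix_mem (p + (n - 1) - q) (by omega) (by omega)
  rw [← cactusGen_conj_suffix ⟨h1, h2, h3⟩, H.mul_mem_cancel_right (H.inv_mem hp),
    H.mul_mem_cancel_left hp, cactusGen_eq_of _ _ _ ⟨h1, h2, h3⟩] at hconj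
  exact hconj
end

section
/- The symplectic cactus group J_{sp(2n)} is generated by the 2n−1 elements s_{[1,j]} for 1 ≤ j ≤ n−1 together with s_{[j,n]} for 1 ≤ j ≤ n. -/
/-- On a valid index, `spGen` is the corresponding generator of the presented group. -/
theorem spGen_eq_of (n p q : ℕ) (h : 1 ≤ p ∧ p ≤ q ∧ q ≤ n) :
    spGen n p q = PresentedGroup.of ⟨(p, q), h⟩ := dif_pos h

/-- Below `n`, the generator `s_{[p,q]}` is the conjugate of `s_{[1,q-p+1]}` by `s_{[1,q]}`. -/
theorem spGen_conj (n p q : ℕ) (hp : 1 ≤ p) (hpq : p ≤ q) (hq : q ≤ n - 1) :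
    spGen n p q = spGen n 1 q * spGen n 1 (q + 1 - p) * (spGen n 1 q)⁻¹ := by
  rw [spGen_eq_of n p q ⟨hp, hpq, by omega⟩, spGen_eq_of n 1 q ⟨le_rfl, by omega, by omega⟩,
    spGen_eq_of n 1 (q + 1 - p) ⟨le_rfl, by omega, by omega⟩]
  have hrel : SpCactusRel n _ :=
    SpCactusRel.nestA ⟨(1, q), by dsimp only; omega⟩ ⟨(1, q + 1 - p), by dsimp only; omega⟩
      ⟨(p, q), by dsimp only; omega⟩ hq le_rfl (by dsimp only; omega) (by dsimp only; omega)
      (by dsimp only; omega)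
  exact (mul_inv_eq_one.mp (PresentedGroup.one_of_mem (rels := {x | SpCactusRel n x}) hrel)).symm

/-- The symplectic cactus group `J_{sp(2n)}` is generated by the `2n-1` elements
`s_{[1,j]}` (`1 ≤ j ≤ n-1`) together with `s_{[j,n]}` (`1 ≤ j ≤ n`). -/
theorem stmt13 (n : ℕ) (hn : 2 ≤ n) :
    Subgroup.closure
      ({x : SpCactusGroup n | ∃ j, 1 ≤ j ∧ j ≤ n - 1 ∧ x = spGen n 1 j}
        ∪ {x : SpCactusGroup n | ∃ j, 1 ≤ j ∧ j ≤ n ∧ x = spGen n j n}) = ⊤ := by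
  rw [eq_top_iff, ← PresentedGroup.closure_range_of, Subgroup.closure_le]
  rintro _ ⟨⟨⟨p, q⟩, hp, hpq, hq⟩, rfl⟩
  rw [← spGen_eq_of n p q ⟨hp, hpq, hq⟩, SetLike.mem_coe]
  dsimp only at hp hpq hq
  obtain rfl | hlt := hq.eq_or_lt
  · exact Subgroup.subset_closure (Or.inr ⟨p, hp, hpq, rfl⟩)
  · have hmem (j : ℕ) (h1 : 1 ≤ j) (h2 : j ≤ n - 1) : spGen n 1 j ∈ Subgroup.closure
        ({x : SpCactusGroup n | ∃ j, 1 ≤ j ∧ j ≤ n - 1 ∧ x = spGen n 1 j}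
          ∪ {x : SpCactusGroup n | ∃ j, 1 ≤ j ∧ j ≤ n ∧ x = spGen n j n}) :=
      Subgroup.subset_closure (Or.inl ⟨j, h1, h2, rfl⟩)
    rw [spGen_conj n p q hp hpq (by omega)]
    exact mul_mem (mul_mem (hmem q (by omega) (by omega)) (hmem _ (by omega) (by omega)))
      (inv_mem (hmem q (by omega) (by omega)))
end

section
/- The virtual symplectic cactus group J̃_{2n} is generated by the 2n−1 elements s̃_{[1,j]∪[2n−j,2n−1]} for 1 ≤ j ≤ n−1 together with s̃_{[j,2n−j]} for 1 ≤ j ≤ n. -/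
/-- Conjugating `s̃_{[1,q+1-p]}` by `s̃_{[1,q]}` gives `s̃_{[p,q]}`, for `q ≤ n - 1`. -/
theorem virtGen_one_conj {n p q : ℕ} (hp : 1 ≤ p) (hpq : p ≤ q) (hq : q ≤ n - 1) :
    virtGen n 1 q * virtGen n 1 (q + 1 - p) * (virtGen n 1 q)⁻¹ = virtGen n p q := by
  have hi : 1 ≤ 1 ∧ 1 ≤ q ∧ q ≤ n := by omega
  have hj : 1 ≤ 1 ∧ 1 ≤ q + 1 - p ∧ q + 1 - p ≤ n := by omega
  have hk : 1 ≤ p ∧ p ≤ q ∧ q ≤ n := by omega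
  rw [virtGen, virtGen, virtGen, dif_pos hi, dif_pos hj, dif_pos hk]
  have h := PresentedGroup.one_of_mem (rels := {x | VirtCactusRel n x})
    (VirtCactusRel.nestA ⟨(1, q), hi⟩ ⟨(1, q + 1 - p), hj⟩ ⟨(p, q), hk⟩ hq le_rfl
      (by dsimp only; omega) (by dsimp only; omega) (by dsimp only; omega))
  simp only [map_mul, map_inv] at h
  exact mul_inv_eq_one.mp h

/-- The virtual symplectic cactus group `J̃_{2n}` is generated by the `2n-1`
elements `s̃_{[1,j]∪[2n-j,2n-1]}` (`1 ≤ j ≤ n-1`) together with `s̃_{[j,2n-j]}`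
(`1 ≤ j ≤ n`). -/
theorem stmt14 (n : ℕ) (hn : 2 ≤ n) :
    Subgroup.closure
      ({x : VirtCactusGroup n | ∃ j, 1 ≤ j ∧ j ≤ n - 1 ∧ x = virtGen n 1 j}
        ∪ {x : VirtCactusGroup n | ∃ j, 1 ≤ j ∧ j ≤ n ∧ x = virtGen n j n}) = ⊤ := by
  rw [eq_top_iff, ← PresentedGroup.closure_range_of, Subgroup.closure_le]
  rintro _ ⟨⟨⟨p, q⟩, hp, hpq, hq⟩, rfl⟩
  dsimp only at hp hpq hq
  rw [← show virtGen n p q = PresentedGroup.of ⟨(p, q), hp, hpq, hq⟩ from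
    dif_pos ⟨hp, hpq, hq⟩]
  rcases hq.eq_or_lt with rfl | hlt
  · exact Subgroup.subset_closure (Or.inr ⟨p, hp, hpq, rfl⟩)
  · rw [← virtGen_one_conj hp hpq (by omega)]
    refine mul_mem (mul_mem ?_ ?_) (inv_mem ?_) <;>
      exact Subgroup.subset_closure (Or.inl ⟨_, by omega, by omega, rfl⟩)
end

section
/- In the symplectic cactus group J_{sp(2n)}, the symplectic Bender–Knuth elements t_i satisfy t_i^2 = 1 for all 1 ≤ i ≤ n−1; consequently the corresponding symplectic Bender–Knuth involutions in the symplectic Berenstein–Kirillov group are involutions. -/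
/-- The symplectic Bender–Knuth elements `t_i`, `1 ≤ i ≤ 2n-1`, of `J_{sp(2n)}`:
`t_1 = s_{[1,1]}`; `t_i = s_{[1,i-1]} s_{[1,i]} s_{[1,i-1]} s_{[1,i-2]}` for
`2 ≤ i ≤ n-1` (with `s_{[1,0]} = 1`); `t_n = s_{[n,n]}`; and
`t_{n+i-1} = s_{[n-i+1,n]} s_{[n-i+2,n]}` for `2 ≤ i ≤ n` (with `s_{[n+1,n]} = 1`).
(Note `spGen` is already `1` on invalid indices, implementing the conventions.) -/
def bk (n : ℕ) (i : ℕ) : SpCactusGroup n :=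
  if i = 1 then spGen n 1 1
  else if i ≤ n - 1 then spGen n 1 (i - 1) * spGen n 1 i * spGen n 1 (i - 1) * spGen n 1 (i - 2)
  else if i = n then spGen n n n
  else spGen n (2 * n - i) n * spGen n (2 * n - i + 1) n

theorem spGen_of_not_le {n p q : ℕ} (h : ¬p ≤ q) : spGen n p q = 1 :=
  dif_neg fun H => h H.2.1

theorem spGen_mul_self (n p q : ℕ) : spGen n p q * spGen n p q = 1 := by
  unfold spGen
  split_ifs with h
  · exact PresentedGroup.one_of_mem (SpCactusRel.sq ⟨(p, q), h⟩)
  · exact one_mul 1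

theorem spGen_mul_spGen_of_nested {n p q k l : ℕ} (hp : 1 ≤ p) (hq : q ≤ n - 1) (hpk : p ≤ k)
    (hkl : k ≤ l) (hlq : l ≤ q) :
    spGen n p q * spGen n k l = spGen n (p + q - l) (p + q - k) * spGen n p q := by
  have hi : 1 ≤ p ∧ p ≤ q ∧ q ≤ n := by omega
  have hj : 1 ≤ k ∧ k ≤ l ∧ l ≤ n := by omega
  have hk : 1 ≤ p + q - l ∧ p + q - l ≤ p + q - k ∧ p + q - k ≤ n := by omega
  have h := PresentedGroup.one_of_mem (rels := {x | SpCactusRel n x})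
    (SpCactusRel.nestA ⟨(p, q), hi⟩ ⟨(k, l), hj⟩ ⟨(p + q - l, p + q - k), hk⟩ hq hpk hlq rfl rfl)
  simp only [map_mul, map_inv] at h
  simp only [spGen, dif_pos hi, dif_pos hj, dif_pos hk]
  exact mul_inv_eq_iff_eq_mul.mp (mul_inv_eq_one.mp h)

/-- The word `a b a c` in involutions squares to `1` when `d = a c a` commutes with `b`. -/
theorem sq_eq_one_of_conj_commute {G : Type*} [Group G] {a b c d : G} (ha : a * a = 1)
    (hb : b * b = 1) (hc : c * c = 1) (hac : a * c = d * a) (hbd : b * d = d * b) :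
    (a * b * a * c) ^ 2 = 1 := by
  have hda : a * d = c * a := by
    rw [← mul_left_inj a, mul_assoc, ← hac, ← mul_assoc, mul_assoc c, ha, one_mul, mul_one]
  have h : Commute (a * b * a) c := by
    calc a * b * a * c = a * (b * d) * a := by simp only [mul_assoc, hac]
      _ = a * d * b * a := by rw [hbd]; simp only [mul_assoc]
      _ = c * (a * b * a) := by rw [hda]; simp only [mul_assoc]
  rw [h.mul_pow, sq c, hc, mul_one, sq]
  calc a * b * a * (a * b * a) = a * b * (a * a) * b * a := by simp only [mul_assoc]
    _ = a * (b * b) * a := by rw [ha, mul_one]; simp only [mul_assoc]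
    _ = 1 := by rw [hb, mul_one, ha]

/-- In `J_{sp(2n)}`, the symplectic Bender–Knuth elements satisfy `t_i² = 1` for
`1 ≤ i ≤ n-1`; consequently the corresponding symplectic Bender–Knuth involutions
in the symplectic Berenstein–Kirillov group (a quotient of `J_{sp(2n)}`) are
involutions. -/
theorem stmt17 (n : ℕ) (hn : 2 ≤ n) (i : ℕ) (hi : 1 ≤ i) (hin : i ≤ n - 1) :
    (bk n i) ^ 2 = 1 := by
  unfold bk
  split_ifs with h1
  · rw [sq, spGen_mul_self]
  · have key {d : SpCactusGroup n}
        (hac : spGen n 1 (i - 1) * spGen n 1 (i - 2) = d * spGen n 1 (i - 1))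
        (hbd : spGen n 1 i * d = d * spGen n 1 i) :=
      sq_eq_one_of_conj_commute (spGen_mul_self n 1 (i - 1)) (spGen_mul_self n 1 i)
        (spGen_mul_self n 1 (i - 2)) hac hbd
    by_cases h2 : i = 2
    · have hc : spGen n 1 (i - 2) = 1 := spGen_of_not_le (by omega)
      exact key (d := 1) (by rw [hc, mul_one, one_mul]) (by rw [mul_one, one_mul])
    · refine key (d := spGen n 2 (i - 1)) ?_ ?_
      · convert spGen_mul_spGen_of_nested (n := n) (p := 1) (q := i - 1) (k := 1) (l := i - 2)
          le_rfl (by omega) le_rfl (by omega) (by omega) using 3 <;> omega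
      · convert spGen_mul_spGen_of_nested (n := n) (p := 1) (q := i) (k := 2) (l := i - 1)
          le_rfl hin (by omega) (by omega) (by omega) using 3 <;> omega
end

section
/- In the symplectic cactus group J_{sp(2n)}, the symplectic Bender–Knuth elements satisfy t_{n+i−1}^2 = 1 and (t_{n+i−1} t_{n+j−1})^2 = 1 (i.e. t_{n+i−1} and t_{n+j−1} commute and are involutions) for all 1 ≤ i, j ≤ n; moreover (t_i t_{n+j−1})^2 = 1 for all 1 ≤ i ≤ n−1 and 1 ≤ j ≤ n with i < n−j. -/
theorem spGen_of_valid {n p q : ℕ} (h : 1 ≤ p ∧ p ≤ q ∧ q ≤ n) :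
    spGen n p q = PresentedGroup.of ⟨(p, q), h⟩ := dif_pos h

theorem spGen_of_invalid {n p q : ℕ} (h : ¬(1 ≤ p ∧ p ≤ q ∧ q ≤ n)) :
    spGen n p q = 1 := dif_neg h

/-- Generators of disjoint non-adjacent intervals commute. -/
theorem spGen_commute_of_lt {n p q k l : ℕ} (hlt : q + 1 < k) :
    Commute (spGen n p q) (spGen n k l) := by
  by_cases h : 1 ≤ p ∧ p ≤ q ∧ q ≤ n
  · by_cases h' : 1 ≤ k ∧ k ≤ l ∧ l ≤ n
    · rw [spGen_of_valid h, spGen_of_valid h']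
      have := PresentedGroup.one_of_mem
        (SpCactusRel.comm (n := n) ⟨(p, q), h⟩ ⟨(k, l), h'⟩ (Or.inl hlt))
      simp only [map_mul] at this
      exact mul_inv_eq_iff_eq_mul.mp (mul_inv_eq_one.mp this)
    · rw [spGen_of_invalid h']
      exact Commute.one_right _
  · rw [spGen_of_invalid h]
    exact Commute.one_left _

/-- The generators `s_{[p,n]}` commute with those of the intervals inside `[p,n]`. -/
theorem spGen_last_commute {n p k l : ℕ} (hpk : p ≤ k) :
    Commute (spGen n p n) (spGen n k l) := by
  by_cases h : 1 ≤ p ∧ p ≤ n ∧ n ≤ n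
  · by_cases h' : 1 ≤ k ∧ k ≤ l ∧ l ≤ n
    · rw [spGen_of_valid h, spGen_of_valid h']
      have := PresentedGroup.one_of_mem
        (SpCactusRel.nestC (n := n) ⟨(p, n), h⟩ ⟨(k, l), h'⟩ rfl hpk)
      simp only [map_mul] at this
      exact mul_inv_eq_iff_eq_mul.mp (mul_inv_eq_one.mp this)
    · rw [spGen_of_invalid h']
      exact Commute.one_right _
  · rw [spGen_of_invalid h]
    exact Commute.one_left _

theorem spGen_last_commute_last (n p k : ℕ) : Commute (spGen n p n) (spGen n k n) :=
  (le_total p k).elim spGen_last_commute fun h => (spGen_last_commute h).symm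

/-- Below the last node, `s_{[p,q]}` reflects the intervals contained in `[p,q]`. -/
theorem spGen_mul_spGen {n p q k l k' l' : ℕ} (hp : 1 ≤ p) (hq : q ≤ n - 1)
    (hpk : p ≤ k) (hkl : k ≤ l) (hlq : l ≤ q) (hk' : k' = p + q - l) (hl' : l' = p + q - k) :
    spGen n p q * spGen n k l = spGen n k' l' * spGen n p q := by
  have h : 1 ≤ p ∧ p ≤ q ∧ q ≤ n := by omega
  have h' : 1 ≤ k ∧ k ≤ l ∧ l ≤ n := by omega
  have h'' : 1 ≤ k' ∧ k' ≤ l' ∧ l' ≤ n := by omega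
  rw [spGen_of_valid h, spGen_of_valid h', spGen_of_valid h'']
  have := PresentedGroup.one_of_mem
    (SpCactusRel.nestA (n := n) ⟨(p, q), h⟩ ⟨(k, l), h'⟩ ⟨(k', l'), h''⟩ hq hpk hlq hk' hl')
  simp only [map_mul] at this
  exact mul_inv_eq_iff_eq_mul.mp (mul_inv_eq_one.mp this)

theorem bk_add_sub_one {n i : ℕ} (hn : 2 ≤ n) (hi : 1 ≤ i) (hin : i ≤ n) :
    bk n (n + i - 1) = spGen n (n + 1 - i) n * spGen n (n + 2 - i) n := by
  unfold bk
  rw [if_neg (by omega), if_neg (by omega)]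
  obtain rfl | hi' := hi.eq_or_lt
  · rw [if_pos (by omega), spGen_of_invalid (p := n + 2 - 1) (by omega), mul_one,
      Nat.add_sub_cancel]
  · rw [if_neg (by omega)]
    congr 2 <;> omega

theorem bk_mul_self {n i : ℕ} (hi : 1 ≤ i) (hin : i ≤ n - 1) : bk n i * bk n i = 1 := by
  unfold bk
  obtain rfl | hi' := hi.eq_or_lt
  · rw [if_pos rfl, spGen_mul_self]
  rw [if_neg (by omega), if_pos hin]
  have ha := spGen_mul_self n 1 (i - 1)
  have hb := spGen_mul_self n 1 i
  have hc := spGen_mul_self n 1 (i - 2)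
  obtain rfl | hi3 := (show 2 ≤ i from hi').eq_or_lt
  · rw [spGen_of_invalid (q := 2 - 2) (by omega)]
    grind
  have hac : spGen n 1 (i - 1) * spGen n 1 (i - 2) = spGen n 2 (i - 1) * spGen n 1 (i - 1) :=
    spGen_mul_spGen le_rfl (by omega) le_rfl (by omega) (by omega) (by omega) (by omega)
  have hbd : spGen n 1 i * spGen n 2 (i - 1) = spGen n 2 (i - 1) * spGen n 1 i :=
    spGen_mul_spGen le_rfl (by omega) (by omega) (by omega) (by omega) (by omega) (by omega)
  generalize spGen n 1 (i - 1) = a at *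
  generalize spGen n 1 i = b at *
  generalize spGen n 1 (i - 2) = c at *
  generalize spGen n 2 (i - 1) = d at *
  calc a * b * a * c * (a * b * a * c) = a * b * (a * c) * a * b * (a * c) := by group
    _ = a * (b * d) * (a * a) * b * d * a := by rw [hac]; group
    _ = a * d * (b * b) * d * a := by rw [hbd, ha]; group
    _ = (a * (d * a)) * (a * (d * a)) := by
      rw [hb, show a * (d * a) * (a * (d * a)) = a * d * (a * a) * d * a by group, ha]
    _ = (a * a * c) * (a * a * c) := by rw [← hac, mul_assoc a a c]
    _ = 1 := by rw [ha, one_mul, hc]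

/-- For `i ≤ n - 1`, `t_i` is a product of generators supported on `[1,i]`. -/
theorem bk_commute {n i k l : ℕ} (hi : 1 ≤ i) (hin : i ≤ n - 1) (hik : i + 1 < k) :
    Commute (bk n i) (spGen n k l) := by
  unfold bk
  split_ifs with h1
  · exact spGen_commute_of_lt (by omega)
  · exact (((spGen_commute_of_lt (by omega)).mul_left (spGen_commute_of_lt (by omega))).mul_left
      (spGen_commute_of_lt (by omega))).mul_left (spGen_commute_of_lt (by omega))

/-- In `J_{sp(2n)}`: `t_{n+i-1}² = 1` and `(t_{n+i-1} t_{n+j-1})² = 1` for all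
`1 ≤ i, j ≤ n`; moreover `(t_i t_{n+j-1})² = 1` for `1 ≤ i ≤ n-1`, `1 ≤ j ≤ n`
with `i < n-j`. -/
theorem stmt18 (n : ℕ) (hn : 2 ≤ n) :
    (∀ i : ℕ, 1 ≤ i → i ≤ n → (bk n (n + i - 1)) ^ 2 = 1) ∧
    (∀ i j : ℕ, 1 ≤ i → i ≤ n → 1 ≤ j → j ≤ n →
      (bk n (n + i - 1) * bk n (n + j - 1)) ^ 2 = 1) ∧
    (∀ i j : ℕ, 1 ≤ i → i ≤ n - 1 → 1 ≤ j → j ≤ n → i < n - j →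
      (bk n i * bk n (n + j - 1)) ^ 2 = 1) := by
  have hcomm : ∀ i j : ℕ, 1 ≤ i → i ≤ n → 1 ≤ j → j ≤ n →
      Commute (bk n (n + i - 1)) (bk n (n + j - 1)) := fun i j hi hin hj hjn => by
    rw [bk_add_sub_one hn hi hin, bk_add_sub_one hn hj hjn]
    have h := spGen_last_commute_last n
    exact ((h _ _).mul_right (h _ _)).mul_left ((h _ _).mul_right (h _ _))
  have hsq : ∀ i : ℕ, 1 ≤ i → i ≤ n → bk n (n + i - 1) ^ 2 = 1 := fun i hi hin => by
    rw [bk_add_sub_one hn hi hin, (spGen_last_commute_last n _ _).mul_pow, sq, sq,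
      spGen_mul_self, spGen_mul_self, one_mul]
  refine ⟨hsq, fun i j hi hin hj hjn => ?_, fun i j hi hin hj hjn hij => ?_⟩
  · rw [(hcomm i j hi hin hj hjn).mul_pow, hsq i hi hin, hsq j hj hjn, one_mul]
  · have h : Commute (bk n i) (bk n (n + j - 1)) := by
      rw [bk_add_sub_one hn hj hjn]
      exact (bk_commute hi hin (by omega)).mul_right (bk_commute hi hin (by omega))
    rw [h.mul_pow, hsq j hj hjn, sq, bk_mul_self hi hin, one_mul]
end
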